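/- arXiv:1802.09400 — 3 statements merged into one kernel-verified Lean document; each statement's English description precedes it below -/
import Mathlib

section
/- Let n ≥ 1 and q ≥ 4. Then there exist δ > 0, constants C′ > 0 and C_α > 0 (one for each multi-index α), a constant A > 0, Schwartz functions F, G on ℝ^n, and a family (m_t)_{t∈[0,1]} of smooth functions on ℝ^{2n} such that: each m_t satisfies |m_t(ξ,η)| ≤ C′ min(|(ξ,η)|, |(ξ,η)|^{−δ}) and |∂^α m_t(ξ,η)| ≤ C_α min(1, |(ξ,η)|^{−δ}) for every multi-index α, each m_t satisfies ‖m_t‖_{L^q(ℝ^{2n})} ≤ A, and sup over t ∈ [0,1] and over finite sets S ⊂ ℤ of ‖Σ_{k∈S} T_{m_t(2^k·)}(F,G)‖_{L^1(ℝ^n)} is infinite, where m_t(2^k·)(ξ,η) = m_t(2^k ξ, 2^k η). (Each finite sum corresponds to the choice r_k = 1 for k ∈ S and r_k = 0 otherwise; consequently, no bound of the form ‖Σ_k r_k T_{m(2^k·)}‖_{L^2×L^2→L^1} ≤ const(C′, C_α, δ, q, ‖m‖_{L^q}), valid for all such m and all sequences (r_k) with |r_k| ≤ 1, can hold when q ≥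 4.) -/
open MeasureTheory Complex Real Set
open scoped FourierTransform RealInnerProductSpace ENNReal

noncomputable section

/-- `ℝ^n` as a Euclidean space. -/
abbrev Rn (n : ℕ) := EuclideanSpace ℝ (Fin n)

/-- The Euclidean norm of a point `(ξ, η) ∈ ℝ^n × ℝ^n ≅ ℝ^{2n}`. -/
def pnorm {n : ℕ} (p : Rn n × Rn n) : ℝ := Real.sqrt (‖p.1‖ ^ 2 + ‖p.2‖ ^ 2)

/-- The bilinear multiplier operator `T_σ` acting on Schwartz functions. -/
def biOp {n : ℕ} (σ : Rn n × Rn n → ℂ) (f g : SchwartzMap (Rn n) ℂ) (x : Rn n) : ℂ :=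
  ∫ ξ : Rn n, ∫ η : Rn n, σ (ξ, η) * 𝓕 (⇑f) ξ * 𝓕 (⇑g) η *
    Complex.exp (2 * Real.pi * Complex.I * ((⟪x, ξ + η⟫ : ℝ) : ℂ))

open Filter Topology

/-- A gliding hump step: adding a far-away term of a sequence that tends to zero pointwise nearly
adds up the `L¹` norms. -/
theorem exists_notMem_integral_norm_add_ge {α : Type*} [MeasurableSpace α] {μ : Measure α}
    {h : ℕ → α → ℂ} (hh : ∀ L, Integrable (h L) μ)
    (hlim : ∀ x, Tendsto (fun L => h L x) atTop (𝓝 0)) {c : ℝ} (hc : 0 < c)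
    (hlow : ∀ L, c ≤ ∫ x, ‖h L x‖ ∂μ) {f : α → ℂ} (hf : Integrable f μ) (S : Finset ℕ) :
    ∃ L ∉ S, (∫ x, ‖f x‖ ∂μ) + c / 2 ≤ ∫ x, ‖h L x + f x‖ ∂μ := by
  have key : Tendsto (fun L => ∫ x, (‖h L x + f x‖ - ‖h L x‖) ∂μ) atTop
      (𝓝 (∫ x, ‖f x‖ ∂μ)) := by
    refine tendsto_integral_of_dominated_convergence (fun x => ‖f x‖) (fun L => ?_) hf.norm
      (fun L => ?_) ?_
    · exact (((hh L).add hf).norm.sub (hh L).norm).aestronglyMeasurable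
    · refine Eventually.of_forall fun x => ?_
      simpa using abs_norm_sub_norm_le (h L x + f x) (h L x)
    · refine Eventually.of_forall fun x => ?_
      simpa using ((hlim x).add_const (f x)).norm.sub (hlim x).norm
  have hev := (key.eventually (lt_mem_nhds (b := ∫ x, ‖f x‖ ∂μ)
    (a := (∫ x, ‖f x‖ ∂μ) - c / 2) (by linarith))).and
    (eventually_gt_atTop (S.sup id))
  obtain ⟨L, hL, hLS⟩ := hev.exists
  refine ⟨L, fun hmem => (Finset.le_sup (f := id) hmem).not_gt hLS, ?_⟩
  have hsum : Integrable (fun x => ‖h L x + f x‖) μ := ((hh L).add hf).norm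
  rw [integral_sub hsum (hh L).norm] at hL
  linarith [hlow L]

theorem exists_finset_lt_eLpNorm_rpow_smul_sum {α : Type*} [MeasurableSpace α] {μ : Measure α}
    {h : ℕ → α → ℂ} (hm : ∀ L, AEStronglyMeasurable (h L) μ)
    (hlim : ∀ x, Tendsto (fun L => h L x) atTop (𝓝 0)) {c : ℝ} (hc : 0 < c)
    (hlow : ∀ L, ENNReal.ofReal c ≤ eLpNorm (h L) 1 μ) (B : ℝ) :
    ∃ S : Finset ℕ, S.Nonempty ∧ ENNReal.ofReal B <
      eLpNorm (fun x => ((S.card : ℝ) ^ (-(1 / 4) : ℝ)) • ∑ L ∈ S, h L x) 1 μ := by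
  by_cases hh : ∀ L, Integrable (h L) μ
  · have hlow' : ∀ L, c ≤ ∫ x, ‖h L x‖ ∂μ := fun L => by
      have := hlow L
      rw [eLpNorm_one_eq_lintegral_enorm, ← ofReal_integral_norm_eq_lintegral_enorm (hh L)] at this
      exact (ENNReal.ofReal_le_ofReal_iff (by positivity)).1 this
    have key : ∀ M : ℕ, ∃ S : Finset ℕ, S.card = M ∧
        M * (c / 2) ≤ ∫ x, ‖∑ L ∈ S, h L x‖ ∂μ := by
      intro M
      induction M with
      | zero => exact ⟨∅, by simp⟩
      | succ M ih =>
        obtain ⟨S, hS, hSM⟩ := ih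
        obtain ⟨L, hLS, hL⟩ := exists_notMem_integral_norm_add_ge hh hlim hc hlow'
          (integrable_finsetSum S fun L _ => hh L) S
        refine ⟨insert L S, by simp [hLS, hS], ?_⟩
        simp only [Finset.sum_insert hLS]
        push_cast
        linarith
    have htend : Tendsto (fun M : ℕ => (M : ℝ) ^ (3 / 4 : ℝ) * (c / 2)) atTop atTop :=
      ((tendsto_rpow_atTop (by norm_num)).comp tendsto_natCast_atTop_atTop).atTop_mul_const
        (by positivity)
    obtain ⟨M, hMB, hM⟩ := ((htend.eventually_gt_atTop (max B 0)).and
      (eventually_gt_atTop 0)).exists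
    obtain ⟨S, hS, hSM⟩ := key M
    refine ⟨S, Finset.card_pos.1 (hS ▸ hM), ?_⟩
    have hM' : (0 : ℝ) < M := by exact_mod_cast hM
    have hsum : Integrable (fun x => ((M : ℝ) ^ (-(1 / 4) : ℝ)) • ∑ L ∈ S, h L x) μ :=
      (integrable_finsetSum S fun L _ => hh L).smul ((M : ℝ) ^ (-(1 / 4) : ℝ))
    rw [eLpNorm_one_eq_lintegral_enorm, hS, ← ofReal_integral_norm_eq_lintegral_enorm hsum]
    simp only [norm_smul]
    rw [integral_const_mul, Real.norm_of_nonneg (by positivity)]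
    have hmul : (M : ℝ) ^ (-(1 / 4) : ℝ) * (M * (c / 2)) = (M : ℝ) ^ (3 / 4 : ℝ) * (c / 2) := by
      rw [← mul_assoc, ← Real.rpow_add_one hM'.ne']
      norm_num
    have hle : (M : ℝ) ^ (-(1 / 4) : ℝ) * (M * (c / 2)) ≤
        (M : ℝ) ^ (-(1 / 4) : ℝ) * ∫ x, ‖∑ L ∈ S, h L x‖ ∂μ := by gcongr
    have h0 := hMB.trans_le (hmul.symm.le.trans hle)
    exact (ENNReal.ofReal_lt_ofReal_iff ((le_max_right _ _).trans_lt h0)).2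
      ((le_max_left _ _).trans_lt h0)
  · push Not at hh
    obtain ⟨L, hL⟩ := hh
    refine ⟨{L}, by simp, ?_⟩
    have : eLpNorm (h L) 1 μ = ⊤ := by
      by_contra hne
      exact hL (memLp_one_iff_integrable.1 ⟨hm L, lt_top_iff_ne_top.2 hne⟩)
    simp [this]

theorem norm_iteratedFDeriv_cexp_mul_I_le (i : ℕ) (t : ℝ) :
    ‖iteratedFDeriv ℝ i (fun s : ℝ => cexp (s * I)) t‖ ≤ 1 := by
  have key : ∀ i : ℕ, iteratedDeriv i (fun s : ℝ => cexp (s * I)) =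
      fun s : ℝ => I ^ i * cexp (s * I) := by
    intro i
    induction i with
    | zero => simp
    | succ i ih =>
      rw [iteratedDeriv_succ, ih]
      funext s
      have h1 : HasDerivAt (fun s : ℝ => cexp (s * I)) (cexp (s * I) * (1 * I)) s :=
        ((Complex.ofRealCLM.hasDerivAt (x := s)).mul_const I).cexp
      rw [(h1.const_mul (I ^ i)).deriv]
      ring
  rw [norm_iteratedFDeriv_eq_norm_iteratedDeriv, key]
  simp [Complex.norm_exp_ofReal_mul_I]

/-- The modulated bump `X(p/N) exp(i N Q(p/N))`, with phase `Q` and amplitude `X`. -/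
def chirp {E : Type*} [AddCommGroup E] [Module ℝ E] (Q : E → ℝ) (X : E → ℂ) (N : ℝ) (p : E) : ℂ :=
  cexp ((N * Q (N⁻¹ • p) : ℝ) * I) * X (N⁻¹ • p)

section
variable {E : Type*} [NormedAddCommGroup E] [NormedSpace ℝ E]

theorem ContDiff.chirp {Q : E → ℝ} {X : E → ℂ} (hQ : ContDiff ℝ (⊤ : ℕ∞) Q)
    (hX : ContDiff ℝ (⊤ : ℕ∞) X) (N : ℝ) : ContDiff ℝ (⊤ : ℕ∞) (chirp Q X N) := by
  unfold _root_.chirp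
  have h1 : ContDiff ℝ (⊤ : ℕ∞) (fun p : E => N⁻¹ • p) := contDiff_id.const_smul _
  exact (((Complex.ofRealCLM.contDiff.comp (contDiff_const.mul (hQ.comp h1))).mul
    contDiff_const).cexp).mul (hX.comp h1)

theorem smul_mem_tsupport_of_mem_tsupport_chirp {Q : E → ℝ} {X : E → ℂ} {N : ℝ} {p : E}
    (hp : p ∈ tsupport (chirp Q X N)) : N⁻¹ • p ∈ tsupport X := by
  have h1 : Function.support (chirp Q X N) ⊆ (fun p : E => N⁻¹ • p) ⁻¹' tsupport X := by
    intro p hp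
    refine subset_tsupport _ fun h => hp ?_
    simp [chirp, h]
  exact closure_minimal h1 ((isClosed_tsupport X).preimage (continuous_const_smul _)) hp

theorem exists_norm_iteratedFDeriv_chirp_le {Q : E → ℝ} {X : E → ℂ} (hQ : ContDiff ℝ (⊤ : ℕ∞) Q)
    (hX : ContDiff ℝ (⊤ : ℕ∞) X) (hXc : HasCompactSupport X) (i : ℕ) :
    ∃ C : ℝ, 0 < C ∧ ∀ N : ℝ, 1 ≤ N → ∀ p, ‖iteratedFDeriv ℝ i (chirp Q X N) p‖ ≤ C := by
  have hle : ∀ j : ℕ, (j : WithTop ℕ∞) ≤ (⊤ : ℕ∞) := fun j => by exact_mod_cast le_top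
  have hKQ : ∀ j : ℕ, ∃ K : ℝ, ∀ u ∈ tsupport X, ‖iteratedFDeriv ℝ j Q u‖ ≤ K := fun j =>
    IsCompact.exists_bound_of_continuousOn hXc (hQ.continuous_iteratedFDeriv (hle j)).continuousOn
  have hKX : ∀ j : ℕ, ∃ K : ℝ, ∀ u ∈ tsupport X, ‖iteratedFDeriv ℝ j X u‖ ≤ K := fun j =>
    IsCompact.exists_bound_of_continuousOn hXc (hX.continuous_iteratedFDeriv (hle j)).continuousOn
  choose K hK using hKQ
  choose KX hKX using hKX
  set D : ℝ := 1 + ∑ j ∈ Finset.range (i + 1), |K j| with hD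
  have hD1 : 1 ≤ D := by
    have : 0 ≤ ∑ j ∈ Finset.range (i + 1), |K j| := by positivity
    linarith
  set C : ℝ := ∑ j ∈ Finset.range (i + 1), (i.choose j : ℝ) * (j.factorial * 1 * D ^ j) *
    |KX (i - j)| with hC
  have hC0 : 0 ≤ C := by positivity
  refine ⟨C + 1, by linarith, fun N hN p => ?_⟩
  by_cases hp : p ∈ tsupport (chirp Q X N)
  swap
  · have : iteratedFDeriv ℝ i (chirp Q X N) p = 0 := by
      by_contra hne
      exact hp (support_iteratedFDeriv_subset (𝕜 := ℝ) i hne)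
    rw [this, norm_zero]
    linarith
  have hN0 : 0 < N := by linarith
  have hinv : ‖N⁻¹‖ ≤ 1 := by
    rw [Real.norm_of_nonneg (by positivity)]
    exact inv_le_one_of_one_le₀ hN
  have hu := smul_mem_tsupport_of_mem_tsupport_chirp hp
  have h1 : ContDiff ℝ (⊤ : ℕ∞) (fun p : E => N⁻¹ • p) := contDiff_id.const_smul _
  have hg : ContDiff ℝ (⊤ : ℕ∞) (fun p : E => N * Q (N⁻¹ • p)) := contDiff_const.mul (hQ.comp h1)
  have hexp : ContDiff ℝ (⊤ : ℕ∞) (fun s : ℝ => cexp (s * I)) :=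
    (Complex.ofRealCLM.contDiff.mul contDiff_const).cexp
  have hgb : ∀ j, 1 ≤ j → j ≤ i →
      ‖iteratedFDeriv ℝ j (fun p : E => N * Q (N⁻¹ • p)) p‖ ≤ D ^ j := by
    intro j hj hji
    have e1 : iteratedFDeriv ℝ j (fun p : E => N * Q (N⁻¹ • p)) p =
        N • ((N⁻¹) ^ j • iteratedFDeriv ℝ j Q (N⁻¹ • p)) := by
      have := iteratedFDeriv_const_smul_apply (𝕜 := ℝ) (a := N) (i := j)
        (f := fun p : E => Q (N⁻¹ • p)) (x := p) ((hQ.comp h1).of_le (hle j)).contDiffAt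
      rw [iteratedFDeriv_comp_const_smul _ (hQ.of_le (hle j))] at this
      exact this
    obtain ⟨k, rfl⟩ := Nat.exists_eq_add_of_le' hj
    rw [e1, norm_smul, norm_smul, norm_pow, ← mul_assoc, pow_succ', ← mul_assoc, ← norm_mul,
      mul_inv_cancel₀ hN0.ne', norm_one, one_mul]
    calc ‖N⁻¹‖ ^ k * ‖iteratedFDeriv ℝ (k + 1) Q (N⁻¹ • p)‖
        ≤ 1 * |K (k + 1)| := by
          gcongr
          · exact pow_le_one₀ (norm_nonneg _) hinv
          · exact (hK _ _ hu).trans (le_abs_self _)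
      _ ≤ D := by
          have := Finset.single_le_sum (f := fun j => |K j|) (fun j _ => abs_nonneg _)
            (Finset.mem_range.2 (Nat.lt_succ_of_le hji))
          linarith
      _ ≤ D ^ (k + 1) := le_self_pow₀ hD1 (by simp)
  have hmul := norm_iteratedFDeriv_mul_le (𝕜 := ℝ) (hexp.comp hg) (hX.comp h1) p (hle i)
  refine (hmul.trans ?_).trans (by linarith : C ≤ C + 1)
  refine Finset.sum_le_sum fun j hj => ?_
  have hji : j ≤ i := Nat.lt_succ_iff.1 (Finset.mem_range.1 hj)
  gcongr
  · exact norm_iteratedFDeriv_comp_le hexp hg (hle j) p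
      (fun k _ => norm_iteratedFDeriv_cexp_mul_I_le k _)
      (fun k hk hkj => hgb k hk (hkj.trans hji))
  · have := congrFun (iteratedFDeriv_comp_const_smul (i := i - j) (N⁻¹) (hX.of_le (hle _))) p
    change ‖iteratedFDeriv ℝ (i - j) (fun z => X (N⁻¹ • z)) p‖ ≤ _
    rw [this, norm_smul, norm_pow]
    calc ‖N⁻¹‖ ^ (i - j) * ‖iteratedFDeriv ℝ (i - j) X (N⁻¹ • p)‖
        ≤ 1 * |KX (i - j)| := by
          gcongr
          · exact pow_le_one₀ (norm_nonneg _) hinv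
          · exact (hKX _ _ hu).trans (le_abs_self _)
      _ = _ := one_mul _

end

/-- The function on `ℝ^n` whose Fourier transform is the push-forward of the chirped density
`K(p) exp(i N ‖ξ + η‖²)` under `p = (ξ, η) ↦ ξ + η`. -/
def dispersed {n : ℕ} (K : Rn n × Rn n → ℂ) (N : ℝ) (x : Rn n) : ℂ :=
  ∫ p : Rn n × Rn n, K p * cexp ((N * ‖p.1 + p.2‖ ^ 2 : ℝ) * I) *
    cexp (2 * π * I * ((⟪x, p.1 + p.2⟫ : ℝ) : ℂ))

theorem norm_cexp_two_pi_I_mul_ofReal (t : ℝ) : ‖cexp (2 * π * I * (t : ℂ))‖ = 1 := by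
  have : 2 * π * I * (t : ℂ) = ((2 * π * t : ℝ) : ℂ) * I := by push_cast; ring
  rw [this, Complex.norm_exp_ofReal_mul_I]

theorem re_sq_pi_div_pos (N : ℝ) : 0 < ((π : ℂ) ^ 2 / (1 + N * I)).re := by
  have hne : (1 + N * I : ℂ) ≠ 0 := fun h => by simpa using congrArg Complex.re h
  have : (π : ℂ) ^ 2 / (1 + N * I) = ((π ^ 2 / (1 + N ^ 2) : ℝ) : ℂ) * (1 - N * I) := by
    have h2 : ((1 : ℂ) + N ^ 2) = (1 + N * I) * (1 - N * I) := by
      ring_nf; rw [Complex.I_sq]; ring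
    have hne' : (1 - N * I : ℂ) ≠ 0 := fun h => by simpa using congrArg Complex.re h
    push_cast
    rw [h2]
    field_simp
  rw [this, Complex.re_ofReal_mul]
  simp
  positivity

section
variable {n : ℕ} {K : Rn n × Rn n → ℂ}

theorem norm_dispersed_le (K : Rn n × Rn n → ℂ) (N : ℝ) (x : Rn n) :
    ‖dispersed K N x‖ ≤ ∫ p, ‖K p‖ := by
  refine (norm_integral_le_integral_norm _).trans_eq ?_
  simp only [norm_mul, norm_cexp_two_pi_I_mul_ofReal, Complex.norm_exp_ofReal_mul_I, mul_one]

theorem stronglyMeasurable_dispersed (hK : Continuous K) (N : ℝ) :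
    StronglyMeasurable (dispersed K N) := by
  refine StronglyMeasurable.integral_prod_right
    (f := fun (x : Rn n) (p : Rn n × Rn n) => K p * cexp ((N * ‖p.1 + p.2‖ ^ 2 : ℝ) * I) *
    cexp (2 * π * I * ((⟪x, p.1 + p.2⟫ : ℝ) : ℂ))) (Continuous.stronglyMeasurable ?_)
  unfold Function.uncurry
  fun_prop

theorem integral_dispersed_mul_gaussian (hK : Continuous K) (hKi : Integrable K) (N : ℝ) :
    ∫ x, dispersed K N x * cexp (-(π ^ 2 / (1 + N * I)) * ‖x‖ ^ 2) =
      ((1 + N * I) / π) ^ ((n / 2 : ℝ) : ℂ) *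
        ∫ p : Rn n × Rn n, K p * cexp (-‖p.1 + p.2‖ ^ 2) := by
  set b : ℂ := π ^ 2 / (1 + N * I) with hb
  have hne : (1 + N * I : ℂ) ≠ 0 := fun h => by simpa using congrArg Complex.re h
  have hπ : (π : ℂ) ≠ 0 := by exact_mod_cast Real.pi_ne_zero
  have hbre : 0 < b.re := re_sq_pi_div_pos N
  have hw : Integrable (fun x : Rn n => cexp (-b * ‖x‖ ^ 2)) := by
    simpa using GaussianFourier.integrable_cexp_neg_mul_sq_norm_add hbre 0 (0 : Rn n)
  have hprod : Integrable (Function.uncurry fun (x : Rn n) (p : Rn n × Rn n) =>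
      K p * cexp ((N * ‖p.1 + p.2‖ ^ 2 : ℝ) * I) *
        cexp (2 * π * I * ((⟪x, p.1 + p.2⟫ : ℝ) : ℂ)) * cexp (-b * ‖x‖ ^ 2))
      ((volume : Measure (Rn n)).prod (volume : Measure (Rn n × Rn n))) := by
    refine (hw.mul_prod hKi).mono ?_ (Eventually.of_forall fun z => ?_)
    · refine Continuous.aestronglyMeasurable ?_
      unfold Function.uncurry
      fun_prop
    · simp only [Function.uncurry, norm_mul, norm_cexp_two_pi_I_mul_ofReal,
        Complex.norm_exp_ofReal_mul_I, mul_one]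
      exact (mul_comm _ _).le
  simp only [dispersed, ← integral_mul_const]
  rw [integral_integral_swap hprod, ← integral_const_mul]
  refine integral_congr_ae (Eventually.of_forall fun p => ?_)
  have hG := GaussianFourier.integral_cexp_neg_mul_sq_norm_add hbre (2 * π * I) (p.1 + p.2)
  have e1 : ∀ x : Rn n, K p * cexp ((N * ‖p.1 + p.2‖ ^ 2 : ℝ) * I) *
        cexp (2 * π * I * ((⟪x, p.1 + p.2⟫ : ℝ) : ℂ)) * cexp (-b * ‖x‖ ^ 2) =
      K p * cexp ((N * ‖p.1 + p.2‖ ^ 2 : ℝ) * I) *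
        cexp (-b * ‖x‖ ^ 2 + 2 * π * I * ((⟪p.1 + p.2, x⟫ : ℝ) : ℂ)) := by
    intro x
    rw [Complex.exp_add, real_inner_comm]
    ring
  simp only [e1]
  rw [integral_const_mul, hG]
  have e2 : (π : ℂ) / b = (1 + N * I) / π := by
    rw [hb]
    field_simp
  have e3 : (2 * π * I) ^ 2 * (‖p.1 + p.2‖ : ℂ) ^ 2 / (4 * b) =
      -(1 + N * I) * (‖p.1 + p.2‖ : ℂ) ^ 2 := by
    rw [hb, mul_pow, Complex.I_sq]
    field_simp
    ring
  have e4 : cexp (-‖p.1 + p.2‖ ^ 2) = cexp ((N * ‖p.1 + p.2‖ ^ 2 : ℝ) * I) *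
      cexp (-(1 + N * I) * (‖p.1 + p.2‖ : ℂ) ^ 2) := by
    rw [← Complex.exp_add]
    congr 1
    push_cast
    ring
  rw [e2, e3, e4, finrank_euclideanSpace_fin]
  push_cast
  ring

theorem le_eLpNorm_dispersed (hK : Continuous K) (hKi : Integrable K) {N : ℝ} (hN : 0 < N) :
    ENNReal.ofReal ((N / π) ^ (n / 2 : ℝ) * ‖∫ p : Rn n × Rn n, K p * cexp (-‖p.1 + p.2‖ ^ 2)‖) ≤
      eLpNorm (dispersed K N) 1 volume := by
  have hle : (N / π) ^ (n / 2 : ℝ) ≤ ‖((1 + N * I) / π : ℂ) ^ ((n / 2 : ℝ) : ℂ)‖ := by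
    rw [Complex.norm_cpow_real]
    refine Real.rpow_le_rpow (by positivity) ?_ (by positivity)
    rw [norm_div, Complex.norm_real, Real.norm_of_nonneg Real.pi_pos.le]
    gcongr
    simpa [abs_of_pos hN] using Complex.abs_im_le_norm (1 + N * I)
  calc ENNReal.ofReal ((N / π) ^ (n / 2 : ℝ) *
        ‖∫ p : Rn n × Rn n, K p * cexp (-‖p.1 + p.2‖ ^ 2)‖)
      ≤ ENNReal.ofReal ‖∫ x, dispersed K N x * cexp (-(π ^ 2 / (1 + N * I)) * ‖x‖ ^ 2)‖ := by
        rw [integral_dispersed_mul_gaussian hK hKi, norm_mul]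
        gcongr
    _ ≤ ∫⁻ x, ‖dispersed K N x * cexp (-(π ^ 2 / (1 + N * I)) * ‖x‖ ^ 2)‖ₑ := by
        rw [ofReal_norm]
        exact enorm_integral_le_lintegral_enorm _
    _ ≤ eLpNorm (dispersed K N) 1 volume := by
        rw [eLpNorm_one_eq_lintegral_enorm]
        refine lintegral_mono fun x => ?_
        rw [enorm_le_iff_norm_le, norm_mul]
        refine mul_le_of_le_one_right (norm_nonneg _) ?_
        rw [Complex.norm_exp, Real.exp_le_one_iff]
        have : (-((π : ℂ) ^ 2 / (1 + N * I)) * (‖x‖ : ℂ) ^ 2).re =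
            -(((π : ℂ) ^ 2 / (1 + N * I)).re * ‖x‖ ^ 2) := by
          rw [← Complex.ofReal_pow ‖x‖, Complex.re_mul_ofReal, Complex.neg_re, neg_mul]
        rw [this, Left.neg_nonpos_iff]
        exact mul_nonneg (re_sq_pi_div_pos N).le (by positivity)

end

/-- The part of `ℝ^n × ℝ^n` where both components have norm comparable to `2^L`. -/
def dyadicShell (n L : ℕ) : Set (Rn n × Rn n) :=
  {p | (3 / 4 * 2 ^ L ≤ ‖p.1‖ ∧ ‖p.1‖ ≤ 5 / 4 * 2 ^ L) ∧
    (3 / 4 * 2 ^ L ≤ ‖p.2‖ ∧ ‖p.2‖ ≤ 5 / 4 * 2 ^ L)}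

section
variable {n : ℕ}

theorem isClosed_dyadicShell (L : ℕ) : IsClosed (dyadicShell n L) := by
  have h1 : Continuous fun p : Rn n × Rn n => ‖p.1‖ := by fun_prop
  have h2 : Continuous fun p : Rn n × Rn n => ‖p.2‖ := by fun_prop
  exact ((isClosed_le continuous_const h1).inter (isClosed_le h1 continuous_const)).inter
    ((isClosed_le continuous_const h2).inter (isClosed_le h2 continuous_const))

theorem le_of_mem_dyadicShell {p : Rn n × Rn n} {L L' : ℕ} (h : p ∈ dyadicShell n L)
    (h' : p ∈ dyadicShell n L') : L ≤ L' := by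
  by_contra! hlt
  have h1 : (2 : ℝ) ^ (L' + 1) ≤ 2 ^ L := pow_le_pow_right₀ one_le_two hlt
  have h2 : (0 : ℝ) < 2 ^ L' := by positivity
  rw [pow_succ] at h1
  linarith [h.1.1, h'.1.2]

theorem eq_of_mem_dyadicShell {p : Rn n × Rn n} {L L' : ℕ} (h : p ∈ dyadicShell n L)
    (h' : p ∈ dyadicShell n L') : L = L' :=
  (le_of_mem_dyadicShell h h').antisymm (le_of_mem_dyadicShell h' h)

theorem smul_mem_dyadicShell_zero_iff (p : Rn n × Rn n) (L : ℕ) :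
    ((2 : ℝ) ^ L)⁻¹ • p ∈ dyadicShell n 0 ↔ p ∈ dyadicShell n L := by
  have h2 : (0 : ℝ) < 2 ^ L := by positivity
  simp only [dyadicShell, mem_ofPred_eq, Prod.smul_fst, Prod.smul_snd, norm_smul, norm_inv,
    norm_pow, Real.norm_ofNat, pow_zero, mul_one, le_inv_mul_iff₀ h2, inv_mul_le_iff₀ h2,
    mul_comm ((2 : ℝ) ^ L)]

theorem pow_le_pnorm {p : Rn n × Rn n} {L : ℕ} (h : p ∈ dyadicShell n L) : 2 ^ L ≤ pnorm p := by
  have h2 : (0 : ℝ) < 2 ^ L := by positivity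
  refine Real.le_sqrt_of_sq_le ?_
  nlinarith [h.1.1, h.2.1]

theorem pnorm_le_two_mul_pow {p : Rn n × Rn n} {L : ℕ} (h : p ∈ dyadicShell n L) :
    pnorm p ≤ 2 * 2 ^ L := by
  have h2 : (0 : ℝ) < 2 ^ L := by positivity
  refine Real.sqrt_le_iff.2 ⟨by positivity, ?_⟩
  nlinarith [h.1.2, h.2.2, norm_nonneg p.1, norm_nonneg p.2]

theorem rpow_neg_le_of_mem_dyadicShell (hn : 1 ≤ n) {p : Rn n × Rn n} {L : ℕ}
    (h : p ∈ dyadicShell n L) :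
    ((2 : ℝ) ^ L) ^ (-(n / 2) : ℝ) ≤ 2 * pnorm p ^ (-(1 / 2) : ℝ) := by
  have h1 : (1 : ℝ) ≤ 2 ^ L := one_le_pow₀ one_le_two
  have hn' : (1 : ℝ) ≤ n := by exact_mod_cast hn
  calc ((2 : ℝ) ^ L) ^ (-(n / 2) : ℝ) ≤ ((2 : ℝ) ^ L) ^ (-(1 / 2) : ℝ) :=
        Real.rpow_le_rpow_of_exponent_le h1 (by linarith)
    _ = 2 * (2 ^ (-1 : ℝ) * ((2 : ℝ) ^ L) ^ (-(1 / 2) : ℝ)) := by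
        rw [Real.rpow_neg_one]; ring
    _ ≤ 2 * (2 ^ (-(1 / 2) : ℝ) * ((2 : ℝ) ^ L) ^ (-(1 / 2) : ℝ)) := by
        gcongr
        · norm_num
        · norm_num
    _ = 2 * (2 * (2 : ℝ) ^ L) ^ (-(1 / 2) : ℝ) := by
        rw [Real.mul_rpow (by positivity) (by positivity)]
    _ ≤ 2 * pnorm p ^ (-(1 / 2) : ℝ) := by
        gcongr 2 * ?_
        exact Real.rpow_le_rpow_of_nonpos (by linarith [pow_le_pnorm h])
          (pnorm_le_two_mul_pow h) (by norm_num)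

theorem volume_dyadicShell (L : ℕ) : volume (dyadicShell n L) =
    ENNReal.ofReal (((2 : ℝ) ^ L) ^ (2 * n)) * volume (dyadicShell n 0) := by
  have e : dyadicShell n L = (fun p => ((2 : ℝ) ^ L)⁻¹ • p) ⁻¹' dyadicShell n 0 := by
    ext p
    exact (smul_mem_dyadicShell_zero_iff p L).symm
  rw [e, Measure.volume_eq_prod, Measure.addHaar_preimage_smul _ (by positivity)]
  congr 2
  rw [Module.finrank_prod, finrank_euclideanSpace_fin, ← two_mul, inv_pow, inv_inv,
    abs_of_pos (by positivity)]

theorem volume_dyadicShell_zero_lt_top : volume (dyadicShell n 0) < ⊤ := by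
  refine (Metric.isBounded_closedBall (x := (0 : Rn n × Rn n)) (r := 2)).subset ?_
    |>.measure_lt_top
  intro p hp
  rw [mem_closedBall_zero_iff, Prod.norm_def]
  have := hp.1.2
  have := hp.2.2
  norm_num at *
  constructor <;> linarith

theorem sum_eq_zero_or_of_dyadicShell {V : Type*} [AddCommMonoid V] {p : Rn n × Rn n} {v : ℕ → V}
    (hv : ∀ L, v L ≠ 0 → p ∈ dyadicShell n L) (S : Finset ℕ) :
    ∑ L ∈ S, v L = 0 ∨ ∃ L ∈ S, p ∈ dyadicShell n L ∧ ∑ L' ∈ S, v L' = v L := by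
  by_cases h : ∃ L ∈ S, v L ≠ 0
  · obtain ⟨L, hL, hvL⟩ := h
    refine Or.inr ⟨L, hL, hv L hvL, Finset.sum_eq_single_of_mem L hL fun L' _ hne => ?_⟩
    by_contra hL'
    exact hne (eq_of_mem_dyadicShell (hv L' hL') (hv L hvL))
  · push Not at h
    exact Or.inl (Finset.sum_eq_zero h)

/-- The quadratic phase `‖ξ + η‖²`. -/
def sumPhase (p : Rn n × Rn n) : ℝ := ‖p.1 + p.2‖ ^ 2

theorem contDiff_sumPhase : ContDiff ℝ (⊤ : ℕ∞) (sumPhase (n := n)) :=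
  (contDiff_fst.add contDiff_snd).norm_sq ℝ

/-- A normalized sum of chirped bumps at the dyadic frequencies `2^L`, `L ∈ S`. -/
def chirpSum (X : Rn n × Rn n → ℂ) (S : Finset ℕ) (p : Rn n × Rn n) : ℂ :=
  ((S.card : ℝ) ^ (-(1 / 4) : ℝ)) •
    ∑ L ∈ S, (((2 : ℝ) ^ L) ^ (-(n / 2) : ℝ)) • chirp sumPhase X (2 ^ L) p

variable {X : Rn n × Rn n → ℂ} {S : Finset ℕ}

theorem card_rpow_le_one (hS : S.Nonempty) : (S.card : ℝ) ^ (-(1 / 4) : ℝ) ≤ 1 :=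
  Real.rpow_le_one_of_one_le_of_nonpos (by exact_mod_cast hS.card_pos) (by norm_num)

theorem mem_dyadicShell_of_mem_tsupport_chirp (hX : tsupport X ⊆ dyadicShell n 0) {L : ℕ}
    {p : Rn n × Rn n} (hp : p ∈ tsupport (chirp sumPhase X (2 ^ L))) : p ∈ dyadicShell n L :=
  (smul_mem_dyadicShell_zero_iff p L).1 (hX (smul_mem_tsupport_of_mem_tsupport_chirp hp))

theorem contDiff_chirpSum (hX : ContDiff ℝ (⊤ : ℕ∞) X) (S : Finset ℕ) :
    ContDiff ℝ (⊤ : ℕ∞) (chirpSum X S) :=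
  (ContDiff.sum fun L _ => (contDiff_sumPhase.chirp hX (2 ^ L)).const_smul _).const_smul _

theorem norm_chirp_le (hX1 : ∀ p, ‖X p‖ ≤ 1) (N : ℝ) (p : Rn n × Rn n) :
    ‖chirp sumPhase X N p‖ ≤ 1 := by
  rw [chirp, norm_mul, Complex.norm_exp_ofReal_mul_I, one_mul]
  exact hX1 _

theorem chirpSum_eq_zero_or (hX1 : ∀ p, ‖X p‖ ≤ 1) (hX : tsupport X ⊆ dyadicShell n 0)
    (S : Finset ℕ) (p : Rn n × Rn n) :
    chirpSum X S p = 0 ∨ ∃ L ∈ S, p ∈ dyadicShell n L ∧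
      ‖chirpSum X S p‖ ≤ (S.card : ℝ) ^ (-(1 / 4) : ℝ) * ((2 : ℝ) ^ L) ^ (-(n / 2) : ℝ) := by
  rcases sum_eq_zero_or_of_dyadicShell (p := p)
    (v := fun L => (((2 : ℝ) ^ L) ^ (-(n / 2) : ℝ)) • chirp sumPhase X (2 ^ L) p)
    (fun L hL => mem_dyadicShell_of_mem_tsupport_chirp hX
      (subset_tsupport _ (right_ne_zero_of_smul hL))) S with h | ⟨L, hL, hp, h⟩
  · exact Or.inl (by rw [chirpSum, h, smul_zero])
  · refine Or.inr ⟨L, hL, hp, ?_⟩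
    rw [chirpSum, h, norm_smul, norm_smul, Real.norm_of_nonneg (by positivity),
      Real.norm_of_nonneg (by positivity)]
    gcongr
    exact mul_le_of_le_one_right (by positivity) (norm_chirp_le hX1 _ _)

theorem norm_chirpSum_le (hn : 1 ≤ n) (hX1 : ∀ p, ‖X p‖ ≤ 1) (hX : tsupport X ⊆ dyadicShell n 0)
    (hS : S.Nonempty) (p : Rn n × Rn n) :
    ‖chirpSum X S p‖ ≤ 2 * min (pnorm p) (pnorm p ^ (-(1 / 2) : ℝ)) := by
  have hp0 : 0 ≤ pnorm p := Real.sqrt_nonneg _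
  rcases chirpSum_eq_zero_or hX1 hX S p with h | ⟨L, -, hp, h⟩
  · rw [h, norm_zero]
    positivity
  · have h1 : (1 : ℝ) ≤ 2 ^ L := one_le_pow₀ one_le_two
    have h2 : ‖chirpSum X S p‖ ≤ ((2 : ℝ) ^ L) ^ (-(n / 2) : ℝ) :=
      h.trans (mul_le_of_le_one_left (by positivity) (card_rpow_le_one hS))
    rw [mul_min_of_nonneg _ _ zero_le_two]
    refine le_min (h2.trans ?_) (h2.trans (rpow_neg_le_of_mem_dyadicShell hn hp))
    have h3 : ((2 : ℝ) ^ L) ^ (-(n / 2) : ℝ) ≤ 1 :=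
      Real.rpow_le_one_of_one_le_of_nonpos h1 (by linarith [n.cast_nonneg (α := ℝ)])
    linarith [pow_le_pnorm hp]

theorem norm_iteratedFDeriv_chirpSum_le (hn : 1 ≤ n) (hXs : ContDiff ℝ (⊤ : ℕ∞) X)
    (hX : tsupport X ⊆ dyadicShell n 0) (hS : S.Nonempty) {i : ℕ} {C : ℝ} (hC : 0 < C)
    (hbd : ∀ N : ℝ, 1 ≤ N → ∀ p, ‖iteratedFDeriv ℝ i (chirp sumPhase X N) p‖ ≤ C)
    (p : Rn n × Rn n) :
    ‖iteratedFDeriv ℝ i (chirpSum X S) p‖ ≤ 2 * C * min 1 (pnorm p ^ (-(1 / 2) : ℝ)) := by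
  have hp0 : 0 ≤ pnorm p := Real.sqrt_nonneg _
  have hi : (i : WithTop ℕ∞) ≤ (⊤ : ℕ∞) := by exact_mod_cast le_top
  have hc : ∀ L : ℕ, ContDiff ℝ i (chirp sumPhase X (2 ^ L)) := fun L =>
    (contDiff_sumPhase.chirp hXs _).of_le hi
  have e : iteratedFDeriv ℝ i (chirpSum X S) p = ((S.card : ℝ) ^ (-(1 / 4) : ℝ)) •
      ∑ L ∈ S, (((2 : ℝ) ^ L) ^ (-(n / 2) : ℝ)) •
        iteratedFDeriv ℝ i (chirp sumPhase X (2 ^ L)) p := by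
    unfold chirpSum
    rw [iteratedFDeriv_const_smul_apply'
      (ContDiff.sum fun L _ => (hc L).const_smul _).contDiffAt,
      iteratedFDeriv_sum fun L _ => (hc L).const_smul _, Finset.sum_apply]
    congr 1
    refine Finset.sum_congr rfl fun L _ => ?_
    exact iteratedFDeriv_const_smul_apply' (hc L).contDiffAt
  rcases sum_eq_zero_or_of_dyadicShell (p := p)
    (v := fun L => (((2 : ℝ) ^ L) ^ (-(n / 2) : ℝ)) •
      iteratedFDeriv ℝ i (chirp sumPhase X (2 ^ L)) p)
    (fun L hL => mem_dyadicShell_of_mem_tsupport_chirp hX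
      (support_iteratedFDeriv_subset (𝕜 := ℝ) i (right_ne_zero_of_smul hL))) S
    with h | ⟨L, hL, hp, h⟩
  · rw [e, h, smul_zero, norm_zero]
    positivity
  · have h1 : (1 : ℝ) ≤ 2 ^ L := one_le_pow₀ one_le_two
    rw [e, h, norm_smul, norm_smul, Real.norm_of_nonneg (by positivity),
      Real.norm_of_nonneg (by positivity)]
    have h3 : ((2 : ℝ) ^ L) ^ (-(n / 2) : ℝ) ≤ 1 :=
      Real.rpow_le_one_of_one_le_of_nonpos h1 (by linarith [n.cast_nonneg (α := ℝ)])
    calc _ ≤ 1 * (((2 : ℝ) ^ L) ^ (-(n / 2) : ℝ) * C) := by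
          gcongr
          · exact card_rpow_le_one hS
          · exact hbd _ h1 p
      _ ≤ 1 * ((2 * min 1 (pnorm p ^ (-(1 / 2) : ℝ))) * C) := by
          gcongr
          rw [mul_min_of_nonneg _ _ zero_le_two]
          exact le_min (by linarith) (rpow_neg_le_of_mem_dyadicShell hn hp)
      _ = _ := by ring

theorem lintegral_enorm_chirpSum_rpow_le (hX1 : ∀ p, ‖X p‖ ≤ 1)
    (hX : tsupport X ⊆ dyadicShell n 0) (hS : S.Nonempty) {q : ℝ} (hq : 4 ≤ q) :
    ∫⁻ p, ‖chirpSum X S p‖ₑ ^ q ≤ volume (dyadicShell n 0) := by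
  have hcard : (1 : ℝ) ≤ S.card := by exact_mod_cast hS.card_pos
  have hpt : ∀ p, ‖chirpSum X S p‖ₑ ^ q ≤ ∑ L ∈ S, (dyadicShell n L).indicator
      (fun _ => ENNReal.ofReal ((S.card : ℝ)⁻¹ * (((2 : ℝ) ^ L) ^ (2 * n))⁻¹)) p := by
    intro p
    rcases chirpSum_eq_zero_or hX1 hX S p with h | ⟨L, hL, hp, h⟩
    · rw [h, enorm_zero, ENNReal.zero_rpow_of_pos (by linarith)]
      exact zero_le
    · refine le_trans ?_ (Finset.single_le_sum (fun _ _ => zero_le) hL)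
      have h1 : (1 : ℝ) ≤ 2 ^ L := one_le_pow₀ one_le_two
      rw [indicator_of_mem hp, ← ofReal_norm, ENNReal.ofReal_rpow_of_nonneg (norm_nonneg _)
        (by linarith)]
      refine ENNReal.ofReal_le_ofReal ((Real.rpow_le_rpow (norm_nonneg _) h (by linarith)).trans ?_)
      rw [Real.mul_rpow (by positivity) (by positivity), ← Real.rpow_mul (by positivity),
        ← Real.rpow_mul (by positivity), ← Real.rpow_neg_one, ← Real.rpow_natCast (2 ^ L : ℝ) (2 * n),
        ← Real.rpow_neg (by positivity)]
      gcongr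
      · linarith
      · push_cast
        nlinarith [n.cast_nonneg (α := ℝ)]
  calc ∫⁻ p, ‖chirpSum X S p‖ₑ ^ q
      ≤ ∫⁻ p, ∑ L ∈ S, (dyadicShell n L).indicator
        (fun _ => ENNReal.ofReal ((S.card : ℝ)⁻¹ * (((2 : ℝ) ^ L) ^ (2 * n))⁻¹)) p :=
        lintegral_mono hpt
    _ = ∑ L ∈ S, ENNReal.ofReal ((S.card : ℝ)⁻¹) * volume (dyadicShell n 0) := by
        rw [lintegral_finsetSum _ fun L _ =>
          measurable_const.indicator (isClosed_dyadicShell L).measurableSet]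
        refine Finset.sum_congr rfl fun L _ => ?_
        rw [lintegral_indicator_const (isClosed_dyadicShell L).measurableSet, volume_dyadicShell,
          ← mul_assoc, ← ENNReal.ofReal_mul (by positivity)]
        congr 2
        field_simp
    _ = volume (dyadicShell n 0) := by
        rw [Finset.sum_const, nsmul_eq_mul, ← mul_assoc, ← ENNReal.ofReal_natCast,
          ← ENNReal.ofReal_mul (by positivity), mul_inv_cancel₀ (by positivity),
          ENNReal.ofReal_one, one_mul]

end

theorem exists_annular_bump {n : ℕ} (hn : 1 ≤ n) : ∃ β : Rn n → ℝ, ContDiff ℝ (⊤ : ℕ∞) β ∧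
    HasCompactSupport β ∧ (∀ ξ, 0 ≤ β ξ) ∧ (∀ ξ, β ξ ≤ 1) ∧
    (∀ ξ ∈ tsupport β, 3 / 4 ≤ ‖ξ‖ ∧ ‖ξ‖ ≤ 5 / 4) ∧ ∃ e, β e ≠ 0 := by
  let e : Rn n := EuclideanSpace.single ⟨0, hn⟩ 1
  have he : ‖e‖ = 1 := by simp [e]
  let b : ContDiffBump e := ⟨1 / 8, 1 / 4, by norm_num, by norm_num⟩
  refine ⟨b, b.contDiff, b.hasCompactSupport, fun ξ => b.nonneg, fun ξ => b.le_one, ?_, e, ?_⟩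
  · intro ξ hξ
    rw [b.tsupport_eq, mem_closedBall_iff_norm] at hξ
    have h1 : ‖ξ - e‖ ≤ 1 / 4 := hξ
    have h2 := abs_le.1 ((abs_norm_sub_norm_le ξ e).trans h1)
    rw [he] at h2
    constructor <;> linarith [h2.1, h2.2]
  · rw [b.one_of_mem_closedBall (by simp [b.rIn_pos.le])]
    exact one_ne_zero

/-- The tensor product `β ⊗ β` as a complex-valued function. -/
def tensorBump {n : ℕ} (β : Rn n → ℝ) (p : Rn n × Rn n) : ℂ := ((β p.1 * β p.2 : ℝ) : ℂ)

section
variable {n : ℕ} {β : Rn n → ℝ}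

theorem contDiff_tensorBump (hβ : ContDiff ℝ (⊤ : ℕ∞) β) : ContDiff ℝ (⊤ : ℕ∞) (tensorBump β) :=
  Complex.ofRealCLM.contDiff.comp ((hβ.comp contDiff_fst).mul (hβ.comp contDiff_snd))

theorem tsupport_tensorBump_subset : tsupport (tensorBump β) ⊆ tsupport β ×ˢ tsupport β := by
  refine closure_minimal (fun p hp => ?_) ((isClosed_tsupport β).prod (isClosed_tsupport β))
  have hp' : β p.1 * β p.2 ≠ 0 := fun h => hp (by simp [tensorBump, h])
  exact ⟨subset_tsupport _ (left_ne_zero_of_mul hp'), subset_tsupport _ (right_ne_zero_of_mul hp')⟩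

theorem hasCompactSupport_tensorBump (hβ : HasCompactSupport β) :
    HasCompactSupport (tensorBump β) :=
  (IsCompact.prod hβ hβ).of_isClosed_subset (isClosed_tsupport _) tsupport_tensorBump_subset

theorem norm_tensorBump_le_one (h0 : ∀ ξ, 0 ≤ β ξ) (h1 : ∀ ξ, β ξ ≤ 1) (p : Rn n × Rn n) :
    ‖tensorBump β p‖ ≤ 1 := by
  rw [tensorBump, Complex.norm_real, Real.norm_of_nonneg (mul_nonneg (h0 _) (h0 _))]
  exact mul_le_one₀ (h1 _) (h0 _) (h1 _)

theorem tsupport_tensorBump_subset_dyadicShell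
    (hβ : ∀ ξ ∈ tsupport β, 3 / 4 ≤ ‖ξ‖ ∧ ‖ξ‖ ≤ 5 / 4) :
    tsupport (tensorBump β) ⊆ dyadicShell n 0 := by
  intro p hp
  have h := tsupport_tensorBump_subset hp
  simpa [dyadicShell] using And.intro (hβ _ h.1) (hβ _ h.2)

theorem chirpSum_pow_smul {X : Rn n × Rn n → ℂ} (hX : tsupport X ⊆ dyadicShell n 0)
    {S : Finset ℕ} {L : ℕ} (hL : L ∈ S) {p : Rn n × Rn n} (hp : X p ≠ 0) :
    chirpSum X S ((2 : ℝ) ^ L • p) = ((S.card : ℝ) ^ (-(1 / 4) : ℝ)) •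
      (((2 : ℝ) ^ L) ^ (-(n / 2) : ℝ)) •
        (cexp (((2 : ℝ) ^ L * ‖p.1 + p.2‖ ^ 2 : ℝ) * I) * X p) := by
  have h2 : (2 : ℝ) ^ L ≠ 0 := by positivity
  have hpL : (2 : ℝ) ^ L • p ∈ dyadicShell n L := by
    rw [← smul_mem_dyadicShell_zero_iff, inv_smul_smul₀ h2]
    exact hX (subset_tsupport _ hp)
  rw [chirpSum, Finset.sum_eq_single_of_mem L hL]
  · rw [chirp, inv_smul_smul₀ h2, sumPhase]
  · intro L' _ hne
    by_contra h
    exact hne (eq_of_mem_dyadicShell (mem_dyadicShell_of_mem_tsupport_chirp hX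
      (subset_tsupport _ (right_ne_zero_of_smul h))) hpL)

theorem biOp_sum_chirpSum (hβc : Continuous β) (hβs : HasCompactSupport β)
    (hβ : ∀ ξ ∈ tsupport β, 3 / 4 ≤ ‖ξ‖ ∧ ‖ξ‖ ≤ 5 / 4) {F : SchwartzMap (Rn n) ℂ}
    (hF : ∀ ξ, 𝓕 (⇑F) ξ = β ξ) (S : Finset ℕ) (x : Rn n) :
    biOp (fun p => ∑ k ∈ S.map (Nat.castEmbedding (R := ℤ)),
      chirpSum (tensorBump β) S ((2 : ℝ) ^ k • p.1, (2 : ℝ) ^ k • p.2)) F F x =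
    ((S.card : ℝ) ^ (-(1 / 4) : ℝ)) • ∑ L ∈ S, (((2 : ℝ) ^ L) ^ (-(n / 2) : ℝ)) •
      dispersed (fun p => tensorBump β p ^ 2) (2 ^ L) x := by
  have hXc : Continuous (tensorBump β) := by unfold tensorBump; fun_prop
  set D : ℕ → Rn n × Rn n → ℂ := fun L p =>
    tensorBump β p ^ 2 * cexp (((2 : ℝ) ^ L * ‖p.1 + p.2‖ ^ 2 : ℝ) * I) *
      cexp (2 * π * I * ((⟪x, p.1 + p.2⟫ : ℝ) : ℂ)) with hD
  have hDi : ∀ L, Integrable (D L) := fun L => by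
    refine Continuous.integrable_of_hasCompactSupport (by fun_prop)
      ((hasCompactSupport_tensorBump hβs).mono fun p hp h => hp ?_)
    simp [hD, h]
  have hpt : ∀ p : Rn n × Rn n, (∑ k ∈ S.map (Nat.castEmbedding (R := ℤ)),
      chirpSum (tensorBump β) S ((2 : ℝ) ^ k • p.1, (2 : ℝ) ^ k • p.2)) * 𝓕 (⇑F) p.1 *
        𝓕 (⇑F) p.2 * cexp (2 * π * I * ((⟪x, p.1 + p.2⟫ : ℝ) : ℂ)) =
      ((S.card : ℝ) ^ (-(1 / 4) : ℝ)) •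
        ∑ L ∈ S, (((2 : ℝ) ^ L) ^ (-(n / 2) : ℝ)) • D L p := by
    intro p
    have hβX : (β p.1 : ℂ) * β p.2 = tensorBump β p := by simp [tensorBump]
    rw [hF, hF, mul_assoc _ (β p.1 : ℂ), hβX]
    by_cases hp : tensorBump β p = 0
    · simp [hD, hp]
    · rw [Finset.sum_map, Finset.sum_mul, Finset.sum_mul, Finset.smul_sum]
      refine Finset.sum_congr rfl fun L hL => ?_
      have := chirpSum_pow_smul (tsupport_tensorBump_subset_dyadicShell hβ) hL hp
      simp only [Nat.castEmbedding_apply, zpow_natCast]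
      rw [Prod.smul_def] at this
      rw [this]
      simp only [hD, Complex.real_smul]
      ring
  have hcDi : ∀ L ∈ S, Integrable fun p => (((2 : ℝ) ^ L) ^ (-(n / 2) : ℝ)) • D L p :=
    fun L _ => (hDi L).smul (((2 : ℝ) ^ L) ^ (-(n / 2) : ℝ))
  have hsum : Integrable fun p => ((S.card : ℝ) ^ (-(1 / 4) : ℝ)) •
      ∑ L ∈ S, (((2 : ℝ) ^ L) ^ (-(n / 2) : ℝ)) • D L p :=
    (integrable_finsetSum S hcDi).smul ((S.card : ℝ) ^ (-(1 / 4) : ℝ))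
  calc _ = ∫ ξ, ∫ η, ((S.card : ℝ) ^ (-(1 / 4) : ℝ)) •
          ∑ L ∈ S, (((2 : ℝ) ^ L) ^ (-(n / 2) : ℝ)) • D L (ξ, η) :=
        integral_congr_ae <| Eventually.of_forall fun ξ =>
          integral_congr_ae <| Eventually.of_forall fun η => hpt (ξ, η)
    _ = ∫ p, ((S.card : ℝ) ^ (-(1 / 4) : ℝ)) •
          ∑ L ∈ S, (((2 : ℝ) ^ L) ^ (-(n / 2) : ℝ)) • D L p := (integral_prod _ hsum).symm
    _ = _ := by
        rw [integral_smul, integral_finsetSum _ hcDi]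
        simp only [integral_smul]
        rfl

theorem norm_integral_tensorBump_sq_pos (hβc : Continuous β) (hβs : HasCompactSupport β) {e : Rn n}
    (he : β e ≠ 0) :
    0 < ‖∫ p : Rn n × Rn n, tensorBump β p ^ 2 * cexp (-‖p.1 + p.2‖ ^ 2)‖ := by
  have e1 : ∀ p : Rn n × Rn n, tensorBump β p ^ 2 * cexp (-‖p.1 + p.2‖ ^ 2) =
      (((β p.1 * β p.2) ^ 2 * Real.exp (-‖p.1 + p.2‖ ^ 2) : ℝ) : ℂ) := by
    intro p
    simp [tensorBump]
  simp only [e1]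
  rw [integral_complex_ofReal, Complex.norm_real, norm_pos_iff]
  refine (Continuous.integral_pos_of_hasCompactSupport_nonneg_nonzero (x := (e, e)) (by fun_prop)
    ((hasCompactSupport_tensorBump hβs).mono fun p hp h => hp ?_) (fun p => by positivity) ?_).ne'
  · have : β p.1 * β p.2 = 0 := by simpa [tensorBump] using h
    simp only [this]
    simp
  · simp [he]

theorem exists_lt_eLpNorm_biOp (hn : 1 ≤ n) (hβc : Continuous β) (hβs : HasCompactSupport β)
    (hβ : ∀ ξ ∈ tsupport β, 3 / 4 ≤ ‖ξ‖ ∧ ‖ξ‖ ≤ 5 / 4) {e : Rn n} (he : β e ≠ 0)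
    {F : SchwartzMap (Rn n) ℂ} (hF : ∀ ξ, 𝓕 (⇑F) ξ = β ξ) (B : ℝ) :
    ∃ S : Finset ℕ, S.Nonempty ∧ ENNReal.ofReal B <
      eLpNorm (biOp (fun p => ∑ k ∈ S.map (Nat.castEmbedding (R := ℤ)),
        chirpSum (tensorBump β) S ((2 : ℝ) ^ k • p.1, (2 : ℝ) ^ k • p.2)) F F) 1 volume := by
  have hKc : Continuous fun p => tensorBump β p ^ 2 := by unfold tensorBump; fun_prop
  have hKi : Integrable fun p => tensorBump β p ^ 2 :=
    hKc.integrable_of_hasCompactSupport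
      ((hasCompactSupport_tensorBump hβs).mono fun p hp h => hp (by simp [h]))
  have hn' : (0 : ℝ) < n / 2 := by
    have : (1 : ℝ) ≤ n := by exact_mod_cast hn
    linarith
  have hκ : Tendsto (fun L : ℕ => ((2 : ℝ) ^ L) ^ (-(n / 2) : ℝ)) atTop (𝓝 0) :=
    (tendsto_rpow_neg_atTop hn').comp (tendsto_pow_atTop_atTop_of_one_lt one_lt_two)
  have hJ := norm_integral_tensorBump_sq_pos hβc hβs he
  obtain ⟨S, hS, hSB⟩ := exists_finset_lt_eLpNorm_rpow_smul_sum
    (μ := (volume : Measure (Rn n)))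
    (h := fun L x => (((2 : ℝ) ^ L) ^ (-(n / 2) : ℝ)) •
      dispersed (fun p => tensorBump β p ^ 2) (2 ^ L) x)
    (c := π ^ (-(n / 2) : ℝ) *
      ‖∫ p : Rn n × Rn n, tensorBump β p ^ 2 * cexp (-‖p.1 + p.2‖ ^ 2)‖)
    (fun L => ((stronglyMeasurable_dispersed hKc (2 ^ L)).const_smul
      (((2 : ℝ) ^ L) ^ (-(n / 2) : ℝ))).aestronglyMeasurable)
    (fun x => by
      refine squeeze_zero_norm (fun L => ?_)
        (by simpa using hκ.mul_const (∫ p, ‖tensorBump β p ^ 2‖))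
      rw [norm_smul, Real.norm_of_nonneg (by positivity)]
      gcongr
      exact norm_dispersed_le _ _ _)
    (by positivity)
    (fun L => by
      have h2 : (0 : ℝ) < 2 ^ L := by positivity
      change _ ≤ eLpNorm ((((2 : ℝ) ^ L) ^ (-(n / 2) : ℝ)) • dispersed _ _) 1 volume
      rw [eLpNorm_const_smul, ← ofReal_norm, Real.norm_of_nonneg (by positivity)]
      refine le_trans (le_of_eq ?_) (mul_le_mul_right (le_eLpNorm_dispersed hKc hKi h2) _)
      rw [← ENNReal.ofReal_mul (by positivity), ← mul_assoc]
      congr 2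
      rw [Real.div_rpow h2.le Real.pi_pos.le, Real.rpow_neg h2.le, Real.rpow_neg Real.pi_pos.le]
      field_simp) B
  refine ⟨S, hS, hSB.trans_eq ?_⟩
  congr 1
  funext x
  exact (biOp_sum_chirpSum hβc hβs hβ hF S x).symm

end

/-- Theorem (necessity part of Theorem 1 of Grafakos–He–Slavíková): for `q ≥ 4`
there exist `δ, C', (C_α), A`, Schwartz functions `F, G` and a family `(m_t)_{t∈[0,1]}`
of smooth functions satisfying the decay conditions uniformly in `t`, with
`‖m_t‖_{L^q} ≤ A`, such that the `L^1` norms of `Σ_{k∈S} T_{m_t(2^k·)}(F,G)` over finite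
sets `S ⊆ ℤ` and `t ∈ [0,1]` are unbounded. -/
theorem statement1 (n : ℕ) (hn : 1 ≤ n) (q : ℝ) (hq : 4 ≤ q) :
    ∃ (δ C' : ℝ) (Cα : ℕ → ℝ) (A : ℝ) (F G : SchwartzMap (Rn n) ℂ)
      (m : ℝ → Rn n × Rn n → ℂ),
      0 < δ ∧ 0 < C' ∧ (∀ i, 0 < Cα i) ∧ 0 < A ∧
      (∀ t ∈ Icc (0 : ℝ) 1, ContDiff ℝ (⊤ : ℕ∞) (m t)) ∧
      (∀ t ∈ Icc (0 : ℝ) 1, ∀ p : Rn n × Rn n,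
        ‖m t p‖ ≤ C' * min (pnorm p) (pnorm p ^ (-δ))) ∧
      (∀ t ∈ Icc (0 : ℝ) 1, ∀ i : ℕ, ∀ p : Rn n × Rn n, p ≠ 0 →
        ‖iteratedFDeriv ℝ i (m t) p‖ ≤ Cα i * min 1 (pnorm p ^ (-δ))) ∧
      (∀ t ∈ Icc (0 : ℝ) 1,
        eLpNorm (m t) (ENNReal.ofReal q) volume ≤ ENNReal.ofReal A) ∧
      (∀ B : ℝ, ∃ t ∈ Icc (0 : ℝ) 1, ∃ S : Finset ℤ,
        ENNReal.ofReal B <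
          eLpNorm
            (biOp (fun p => ∑ k ∈ S, m t ((2 : ℝ) ^ k • p.1, (2 : ℝ) ^ k • p.2)) F G)
            1 volume) := by
  obtain ⟨β, hβ, hβs, hβ0, hβ1, hβt, e, he⟩ := exists_annular_bump hn
  have hβs' : HasCompactSupport fun ξ => (β ξ : ℂ) := hβs.comp_left Complex.ofReal_zero
  have hβ' : ContDiff ℝ (⊤ : ℕ∞) fun ξ => (β ξ : ℂ) := Complex.ofRealCLM.contDiff.comp hβ
  let F : SchwartzMap (Rn n) ℂ := 𝓕⁻ (hβs'.toSchwartzMap hβ')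
  have hF : ∀ ξ, 𝓕 (⇑F) ξ = β ξ := fun ξ => by
    rw [← SchwartzMap.fourier_coe, FourierTransform.fourier_fourierInv_eq]
    rfl
  have hX := contDiff_tensorBump hβ
  have hX1 := norm_tensorBump_le_one hβ0 hβ1
  have hXt := tsupport_tensorBump_subset_dyadicShell hβt
  choose C hC0 hC using exists_norm_iteratedFDeriv_chirp_le contDiff_sumPhase hX
    (hasCompactSupport_tensorBump hβs)
  choose S hS hSB using fun j : ℕ =>
    exists_lt_eLpNorm_biOp hn hβ.continuous hβs hβt he hF (j : ℝ)
  refine ⟨1 / 2, 2, fun i => 2 * C i, (volume (dyadicShell n 0)).toReal ^ (1 / q) + 1, F, F,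
    fun t => chirpSum (tensorBump β) (S ⌊1 / t⌋₊), by norm_num, by norm_num,
    fun i => mul_pos two_pos (hC0 i), by positivity, fun t _ => contDiff_chirpSum hX _,
    fun t _ p => norm_chirpSum_le hn hX1 hXt (hS _) p,
    fun t _ i p _ => norm_iteratedFDeriv_chirpSum_le hn hX hXt (hS _) (hC0 i) (hC i) p,
    fun t _ => ?_, fun B => ?_⟩
  · have hq0 : 0 < q := by linarith
    rw [eLpNorm_eq_lintegral_rpow_enorm_toReal (by simpa using hq0) ENNReal.ofReal_ne_top,
      ENNReal.toReal_ofReal hq0.le]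
    refine (ENNReal.rpow_le_rpow (lintegral_enorm_chirpSum_rpow_le hX1 hXt (hS _) hq)
      (by positivity)).trans ?_
    rw [← ENNReal.ofReal_toReal volume_dyadicShell_zero_lt_top.ne,
      ENNReal.ofReal_rpow_of_nonneg ENNReal.toReal_nonneg (by positivity),
      ENNReal.toReal_ofReal ENNReal.toReal_nonneg]
    exact ENNReal.ofReal_le_ofReal (by linarith)
  · obtain ⟨j, hj⟩ := exists_nat_ge (max B 1)
    have hj1 : (1 : ℝ) ≤ j := (le_max_right _ _).trans hj
    refine ⟨1 / j, ⟨by positivity, by rw [div_le_one (by positivity)]; exact hj1⟩,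
      (S j).map Nat.castEmbedding, ?_⟩
    simp only [one_div_one_div, Nat.floor_natCast]
    exact (ENNReal.ofReal_le_ofReal ((le_max_left _ _).trans hj)).trans_lt (hSB j)
end
end

section
/- Let n ≥ 1 and M ≥ 0 be integers. Let ψ, φ₂, …, φ_{2n} be continuous compactly supported functions on ℝ, where ψ satisfies the moment conditions ∫_ℝ y^β ψ(y) dy = 0 for all integers 0 ≤ β ≤ M. Define Ψ(x₁, …, x_{2n}) = ψ(x₁) φ₂(x₂) ⋯ φ_{2n}(x_{2n}). Let m be a C^{M+1} function on ℝ^{2n} with ‖∂^α m‖_{L^∞(ℝ^{2n})} ≤ C₀ < ∞ for all multi-indices α with |α| ≤ M+1. Then there is a constant C, depending only on n, M, and the functions ψ, φ₂, …, φ_{2n} (via their supports and sup norms), such that for every integer λ ≥ 0 and every μ ∈ ℤ^{2n}, |∫_{ℝ^{2n}} 2^{λn} Ψ(2^λ x − μ) m(x) dx| ≤ C · C₀ · 2^{−(M+1+n)λ}. -/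
open MeasureTheory Complex Real
open scoped ENNReal

noncomputable section

/-- A compactly supported function with vanishing moments up to order `M` annihilates every
translated monomial of degree at most `M`. -/
theorem integral_mul_sub_pow_eq_zero {M : ℕ} {ψ : ℝ → ℝ} (hc : Continuous ψ)
    (hs : HasCompactSupport ψ) (hmom : ∀ β : ℕ, β ≤ M → ∫ y : ℝ, y ^ β * ψ y = 0)
    (a : ℝ) {k : ℕ} (hk : k ≤ M) : ∫ t : ℝ, ψ t * (t - a) ^ k = 0 := by
  have hint : ∀ j : ℕ, Integrable fun t : ℝ => t ^ j * ψ t := fun j =>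
    ((continuous_pow j).mul hc).integrable_of_hasCompactSupport hs.mul_left
  have hexp : ∀ t : ℝ, ψ t * (t - a) ^ k =
      ∑ j ∈ Finset.range (k + 1), ((-a) ^ (k - j) * (k.choose j : ℝ)) * (t ^ j * ψ t) := by
    intro t
    rw [sub_eq_add_neg, add_pow, Finset.mul_sum]
    exact Finset.sum_congr rfl fun j _ => by ring
  simp_rw [hexp]
  rw [integral_finsetSum _ fun j _ => (hint j).const_mul _]
  refine Finset.sum_eq_zero fun j hj => ?_
  rw [integral_const_mul, hmom j (by have := Finset.mem_range.1 hj; omega), mul_zero]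

/-- Integrating against a function with vanishing moments up to order `M` is controlled by the
derivative of order `M + 1`. -/
theorem exists_norm_integral_mul_le_of_moments {M : ℕ} {ψ : ℝ → ℝ} (hc : Continuous ψ)
    (hs : HasCompactSupport ψ) (hmom : ∀ β : ℕ, β ≤ M → ∫ y : ℝ, y ^ β * ψ y = 0) :
    ∃ K : ℝ, 0 ≤ K ∧ ∀ (h : ℝ → ℂ) (A : ℝ), ContDiff ℝ (M + 1 : ℕ) h →
      (∀ t, ‖iteratedDeriv (M + 1) h t‖ ≤ A) → ‖∫ t : ℝ, (ψ t : ℂ) * h t‖ ≤ K * A := by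
  obtain ⟨R, hR, hsub⟩ := hs.isCompact.isBounded.subset_closedBall_lt 0 0
  rw [Real.closedBall_eq_Icc, zero_sub, zero_add] at hsub
  have hψi : Integrable fun t => |ψ t| := (hc.integrable_of_hasCompactSupport hs).abs
  refine ⟨(2 * R) ^ (M + 1) / (M.factorial : ℝ) * ∫ t, |ψ t|, by positivity, ?_⟩
  intro h A hh hA
  have hA0 : 0 ≤ A := (norm_nonneg _).trans (hA 0)
  set P : ℝ → ℂ := fun x => taylorWithinEval h M (Set.Icc (-R) R) (-R) x with hP
  have hPsum : ∀ t, (ψ t : ℂ) * P t = ∑ k ∈ Finset.range (M + 1),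
      (((ψ t * (t - -R) ^ k : ℝ) : ℂ)) *
        ((((k.factorial : ℝ)⁻¹ : ℝ) : ℂ) * iteratedDerivWithin k h (Set.Icc (-R) R) (-R)) := by
    intro t
    simp only [hP, taylor_within_apply, Finset.mul_sum, Complex.real_smul]
    exact Finset.sum_congr rfl fun k _ => by push_cast; ring
  have hterm : ∀ k : ℕ, Integrable fun t : ℝ => ((ψ t * (t - -R) ^ k : ℝ) : ℂ) := fun k =>
    ((hc.mul ((continuous_id.sub continuous_const).pow k)).integrable_of_hasCompactSupport
      hs.mul_right).ofReal
  have hPint : Integrable fun t => (ψ t : ℂ) * P t := by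
    simp_rw [hPsum]
    exact integrable_finsetSum _ fun k _ => (hterm k).mul_const _
  have hPzero : ∫ t, (ψ t : ℂ) * P t = 0 := by
    simp_rw [hPsum]
    rw [integral_finsetSum _ fun k _ => (hterm k).mul_const _]
    refine Finset.sum_eq_zero fun k hk => ?_
    rw [integral_mul_const, integral_complex_ofReal, integral_mul_sub_pow_eq_zero hc hs hmom (-R)
      (by have := Finset.mem_range.1 hk; omega)]
    simp
  have hhint : Integrable fun t => (ψ t : ℂ) * h t := by
    refine Continuous.integrable_of_hasCompactSupport
      ((Complex.continuous_ofReal.comp hc).mul hh.continuous) ?_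
    exact (hs.comp_left (g := ((↑) : ℝ → ℂ)) Complex.ofReal_zero).mul_right
  have hrem : ∀ t, ‖(ψ t : ℂ) * h t - (ψ t : ℂ) * P t‖ ≤
      |ψ t| * (A * (2 * R) ^ (M + 1) / (M.factorial : ℝ)) := by
    intro t
    rw [← mul_sub, norm_mul, Complex.norm_real, Real.norm_eq_abs]
    by_cases ht : t ∈ Set.Icc (-R) R
    · gcongr
      refine (taylor_mean_remainder_bound (C := A) (by linarith) ?_ ht ?_).trans ?_
      · exact_mod_cast hh.contDiffOn
      · intro y hy
        rw [iteratedDerivWithin_eq_iteratedDeriv (uniqueDiffOn_Icc (by linarith))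
          hh.contDiffAt hy]
        exact hA y
      · have h1 := ht.1
        have h2 := ht.2
        gcongr
        linarith
    · rw [show ψ t = 0 from image_eq_zero_of_notMem_tsupport fun h => ht (hsub h)]
      simp
  rw [← sub_zero (∫ t, (ψ t : ℂ) * h t), ← hPzero, ← integral_sub hhint hPint]
  refine (norm_integral_le_of_norm_le (hψi.mul_const _) (.of_forall hrem)).trans_eq ?_
  rw [integral_mul_const]
  ring

/-- Integrating against a tensor product, one factor of which has vanishing moments up to order
`M`, is controlled by the partial derivative of order `M + 1` in the corresponding variable. -/
theorem exists_norm_integral_prod_mul_le_of_moments {N M : ℕ} {g : Fin N → ℝ → ℝ}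
    (hc : ∀ r, Continuous (g r)) (hs : ∀ r, HasCompactSupport (g r)) (i : Fin N)
    (hmom : ∀ β : ℕ, β ≤ M → ∫ y : ℝ, y ^ β * g i y = 0) :
    ∃ K : ℝ, 0 ≤ K ∧ ∀ (F : (Fin N → ℝ) → ℂ) (A : ℝ),
      (∀ y, ContDiff ℝ (M + 1 : ℕ) fun t => F (Function.update y i t)) →
      (∀ y t, ‖iteratedDeriv (M + 1) (fun t => F (Function.update y i t)) t‖ ≤ A) →
      ‖∫ y : Fin N → ℝ, ((∏ r, g r (y r) : ℝ) : ℂ) * F y‖ ≤ K * A := by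
  obtain _ | k := N
  · exact i.elim0
  obtain ⟨K, hK, hbound⟩ := exists_norm_integral_mul_le_of_moments (hc i) (hs i) hmom
  have hprod : Integrable fun z : Fin k → ℝ => ∏ r, |g (i.succAbove r) (z r)| :=
    Integrable.fintype_prod (f := fun r t => |g (i.succAbove r) t|) fun r =>
      ((hc _).integrable_of_hasCompactSupport (hs _)).abs
  refine ⟨(∫ z : Fin k → ℝ, ∏ r, |g (i.succAbove r) (z r)|) * K,
    mul_nonneg (integral_nonneg fun z => Finset.prod_nonneg fun r _ => abs_nonneg _) hK, ?_⟩
  intro F A hF hA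
  have hA0 : 0 ≤ A := (norm_nonneg _).trans (hA 0 0)
  have hmp := (volume_preserving_piFinSuccAbove (fun _ : Fin (k + 1) => ℝ) i).symm
  rw [← hmp.integral_comp (MeasurableEquiv.measurableEmbedding _)]
  by_cases hint : Integrable fun p : ℝ × (Fin k → ℝ) =>
      ((∏ r, g r ((MeasurableEquiv.piFinSuccAbove (fun _ => ℝ) i).symm p r) : ℝ) : ℂ) *
        F ((MeasurableEquiv.piFinSuccAbove (fun _ => ℝ) i).symm p)
  swap
  · rw [integral_undef hint, norm_zero]
    exact mul_nonneg (mul_nonneg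
      (integral_nonneg fun z => Finset.prod_nonneg fun r _ => abs_nonneg _) hK) hA0
  rw [Measure.volume_eq_prod, integral_prod_symm _ hint, mul_assoc, ← integral_mul_const]
  refine norm_integral_le_of_norm_le (hprod.mul_const _) (.of_forall fun z => ?_)
  have hslice : ∀ t : ℝ,
      ((∏ r, g r ((MeasurableEquiv.piFinSuccAbove (fun _ => ℝ) i).symm (t, z) r) : ℝ) : ℂ) *
        F ((MeasurableEquiv.piFinSuccAbove (fun _ => ℝ) i).symm (t, z)) =
      ((∏ r, g (i.succAbove r) (z r) : ℝ) : ℂ) *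
        ((g i t : ℂ) * F (Function.update (i.insertNth 0 z : Fin (k + 1) → ℝ) i t)) := by
    intro t
    have he : (MeasurableEquiv.piFinSuccAbove (fun _ => ℝ) i).symm (t, z) =
      (i.insertNth t z : Fin (k + 1) → ℝ) := rfl
    rw [he, Fin.update_insertNth, Fin.prod_univ_succAbove _ i]
    simp only [Fin.insertNth_apply_same, Fin.insertNth_apply_succAbove]
    push_cast
    ring
  simp_rw [hslice]
  rw [integral_const_mul, norm_mul, Complex.norm_real, Real.norm_eq_abs, Finset.abs_prod]
  gcongr
  exact hbound _ A (hF _) (hA _)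

/-- The iterated derivative along an affine line is bounded by the full iterated derivative. -/
theorem norm_iteratedDeriv_comp_add_smul_le {E F : Type*} [NormedAddCommGroup E]
    [NormedSpace ℝ E] [NormedAddCommGroup F] [NormedSpace ℝ F] {f : E → F} {k : ℕ}
    (hf : ContDiff ℝ k f) (p v : E) (t : ℝ) :
    ‖iteratedDeriv k (fun s : ℝ => f (p + s • v)) t‖ ≤
      ‖iteratedFDeriv ℝ k f (p + t • v)‖ * ‖v‖ ^ k := by
  have hcomp : (fun s : ℝ => f (p + s • v)) =
      (fun x => f (p + x)) ∘ ContinuousLinearMap.toSpanSingleton ℝ v := by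
    ext s
    simp
  have hshift : ContDiff ℝ k fun x => f (p + x) := hf.comp (contDiff_const.add contDiff_id)
  rw [← norm_iteratedFDeriv_eq_norm_iteratedDeriv, hcomp,
    ContinuousLinearMap.iteratedFDeriv_comp_right _ hshift _ le_rfl]
  refine (ContinuousMultilinearMap.norm_compContinuousLinearMap_le _ _).trans_eq ?_
  rw [iteratedFDeriv_comp_add_left]
  simp

/-- Lemma 1 of Grafakos–He–Slavíková (wavelet coefficient decay): if
`Ψ(x) = ψ(x₁) φ₂(x₂) ⋯ φ_{2n}(x_{2n})` is a product of continuous compactly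
supported functions, the first of which has vanishing moments up to order `M`,
and `m ∈ C^{M+1}(ℝ^{2n})` has all partial derivatives of order `≤ M+1` bounded
by `C₀`, then `|⟨2^{λn} Ψ(2^λ · − μ), m⟩| ≤ C C₀ 2^{−(M+1+n)λ}` uniformly in
`λ ≥ 0` and `μ ∈ ℤ^{2n}`.  Here `g 0 = ψ` and `g r = φ_{r+1}` for `r ≥ 1`. -/
theorem statement6 (n M : ℕ) (hn : 1 ≤ n) (g : Fin (2 * n) → ℝ → ℝ)
    (hg_cont : ∀ r, Continuous (g r))
    (hg_supp : ∀ r, HasCompactSupport (g r))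
    (hmom : ∀ β : ℕ, β ≤ M →
      ∫ y : ℝ, y ^ β * g (⟨0, by omega⟩ : Fin (2 * n)) y = 0) :
    ∃ C : ℝ, 0 < C ∧
      ∀ (m : EuclideanSpace ℝ (Fin (2 * n)) → ℂ) (C₀ : ℝ),
        ContDiff ℝ (M + 1 : ℕ) m →
        (∀ i ≤ M + 1, ∀ x, ‖iteratedFDeriv ℝ i m x‖ ≤ C₀) →
        ∀ (lam : ℕ) (μ : Fin (2 * n) → ℤ),
          ‖∫ x : EuclideanSpace ℝ (Fin (2 * n)),
              ((((2 : ℝ) ^ (lam * n) *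
                  ∏ r : Fin (2 * n), g r ((2 : ℝ) ^ lam * x r - μ r) : ℝ) : ℂ)) * m x‖
            ≤ C * C₀ * (2 : ℝ) ^ (-(((M + 1 + n) * lam : ℕ) : ℤ)) := by
  obtain ⟨K, hK, hbound⟩ :=
    exists_norm_integral_prod_mul_le_of_moments hg_cont hg_supp ⟨0, by omega⟩ hmom
  refine ⟨K + 1, by linarith, ?_⟩
  intro m C₀ hm hC lam μ
  set L : ℝ := (2 : ℝ) ^ lam with hL
  have hLpos : 0 < L := by positivity
  have hC0 : 0 ≤ C₀ := (norm_nonneg _).trans (hC 0 (Nat.zero_le _) 0)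
  set i : Fin (2 * n) := ⟨0, by omega⟩
  set shift : Fin (2 * n) → ℝ := fun r => (μ r : ℝ)
  set F : (Fin (2 * n) → ℝ) → ℂ := fun y => m (WithLp.toLp 2 (L⁻¹ • (y + shift))) with hF
  set v : EuclideanSpace ℝ (Fin (2 * n)) := EuclideanSpace.single i L⁻¹ with hv
  have hline : ∀ y : Fin (2 * n) → ℝ, (fun t => F (Function.update y i t)) =
      fun t : ℝ => m (WithLp.toLp 2 (L⁻¹ • (Function.update y i 0 + shift)) + t • v) := by
    intro y
    funext t
    simp only [hF]
    congr 1
    ext r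
    by_cases hr : r = i
    · subst hr
      simp [hv]
      ring
    · simp [hv, hr, mul_add]
  have hvnorm : ‖v‖ = L⁻¹ := by
    simp [hv, abs_of_pos hLpos]
  have hmain := hbound F (C₀ * L⁻¹ ^ (M + 1))
    (fun y => by
      rw [hline]
      exact hm.comp (contDiff_const.add (contDiff_id.smul contDiff_const)))
    (fun y t => by
      rw [hline]
      refine (norm_iteratedDeriv_comp_add_smul_le hm _ _ _).trans ?_
      rw [hvnorm]
      gcongr
      exact hC _ le_rfl _)
  have hchange : ∫ x : EuclideanSpace ℝ (Fin (2 * n)),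
      (((2 : ℝ) ^ (lam * n) * ∏ r : Fin (2 * n), g r (L * x r - μ r) : ℝ) : ℂ) * m x =
      ((L ^ n * (L ^ (2 * n))⁻¹ : ℝ) : ℂ) *
        ∫ y : Fin (2 * n) → ℝ, ((∏ r, g r (y r) : ℝ) : ℂ) * F y := by
    rw [← (PiLp.volume_preserving_toLp (Fin (2 * n))).integral_comp
      (MeasurableEquiv.toLp 2 _).measurableEmbedding,
      ← integral_sub_right_eq_self (fun y => ((∏ r, g r (y r) : ℝ) : ℂ) * F y) shift]
    have hscale := Measure.integral_comp_smul (volume : Measure (Fin (2 * n) → ℝ))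
      (fun y => ((∏ r, g r ((y - shift) r) : ℝ) : ℂ) * F (y - shift)) L
    rw [Module.finrank_fin_fun, abs_of_pos (by positivity), Complex.real_smul] at hscale
    rw [Complex.ofReal_mul, mul_assoc, ← hscale, ← integral_const_mul]
    refine integral_congr_ae (.of_forall fun x => ?_)
    simp only [hF, sub_add_cancel, smul_smul, inv_mul_cancel₀ hLpos.ne', one_smul]
    simp only [Pi.sub_apply, Pi.smul_apply, smul_eq_mul, shift, hL, pow_mul]
    push_cast
    ring
  have hexp : (2 : ℝ) ^ (-(((M + 1 + n) * lam : ℕ) : ℤ)) =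
      (L ^ n * (L ^ (2 * n))⁻¹) * L⁻¹ ^ (M + 1) := by
    rw [zpow_neg, zpow_natCast, mul_comm (M + 1 + n), pow_mul, ← hL, inv_pow]
    field_simp
    ring
  rw [hchange, norm_mul, Complex.norm_real, Real.norm_of_nonneg (by positivity), hexp]
  calc _ ≤ (L ^ n * (L ^ (2 * n))⁻¹) * (K * (C₀ * L⁻¹ ^ (M + 1))) := by gcongr
    _ = K * C₀ * ((L ^ n * (L ^ (2 * n))⁻¹) * L⁻¹ ^ (M + 1)) := by ring
    _ ≤ _ := by gcongr; linarith
end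
end

section
/- Let n ≥ 1. Let φ be a Schwartz function on ℝ whose Fourier transform φ̂ is supported in [−1/100, 1/100], and let ψ be a smooth function on ℝ supported in [−1/10, 1/10] with ψ = 1 on [−1/20, 1/20]. Let (b_j)_{j≥1} and (d_k)_{k≥1} be sequences of nonnegative reals with only finitely many nonzero terms, and let (c_l)_{l≥2} be a bounded sequence of nonnegative reals. Define Schwartz functions f, g on ℝ^n via f̂(ξ) = Σ_{j≥1} b_j φ̂(ξ₁ − j) Π_{r=2}^n φ̂(ξ_r − 1) and ĝ(η) = Σ_{k≥1} d_k φ̂(η₁ − k) Π_{r=2}^n φ̂(η_r − 1). Let (a_j)_{j≥1} be the Rademacher functions on [0,1], a_j(t) = sign(sin(2^j π t)), and for t ∈ [0,1] define m_t(ξ,η) = Σ_{j≥1} Σ_{k≥1} a_{j+k}(t) c_{j+k} ψ(ξ₁ − j) ψ(η₁ − k) Π_{r=2}^n ψ(ξ_r − 1) ψ(η_r − 1). Then there exist absolute constants 0 < c ≤ C (independent of n, φ, ψ, and the sequences) such that c · Q ≤ ∫_0^1 ‖T_{m_t}(f,g)‖_{L^1(ℝ^n)} dt ≤ C · Q, where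 Q = (Σ_{l≥2} c_l² (Σ_{j=1}^{l−1} b_j d_{l−j})²)^{1/2} · (∫_ℝ |φ(y)|² dy)^n. -/
open MeasureTheory Complex Real Set
open scoped FourierTransform RealInnerProductSpace ENNReal

noncomputable section

/-- The Rademacher function `a_l(t) = sign(sin(2^l π t))`. -/
def rademacher (l : ℕ) (t : ℝ) : ℝ := Real.sign (Real.sin (2 ^ l * Real.pi * t))

lemma rademacher_succ (l : ℕ) (t : ℝ) : rademacher (l + 1) t = rademacher l (2 * t) := by
  unfold rademacher
  congr 2
  ring

lemma rademacher_succ_add_one (l : ℕ) (t : ℝ) :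
    rademacher (l + 1) (t + 1) = rademacher (l + 1) t := by
  unfold rademacher
  have h : (2 : ℝ) ^ (l + 1) * π * (t + 1) = 2 ^ (l + 1) * π * t + (2 ^ l : ℕ) * (2 * π) := by
    push_cast
    ring
  rw [h, Real.sin_add_nat_mul_two_pi]

lemma rademacher_one_of_lt_half {t : ℝ} (h0 : 0 < t) (h1 : t < 1 / 2) : rademacher 1 t = 1 := by
  refine Real.sign_of_pos (Real.sin_pos_of_pos_of_lt_pi (by positivity) ?_)
  nlinarith [Real.pi_pos]

lemma rademacher_one_of_half_lt {t : ℝ} (h0 : 1 / 2 < t) (h1 : t < 1) : rademacher 1 t = -1 := by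
  refine Real.sign_of_neg ?_
  rw [← Real.sin_sub_two_pi]
  refine Real.sin_neg_of_neg_of_neg_pi_lt ?_ ?_ <;> nlinarith [Real.pi_pos]

lemma abs_rademacher_le_one (l : ℕ) (t : ℝ) : |rademacher l t| ≤ 1 := by
  unfold rademacher
  rcases Real.sign_apply_eq (Real.sin (2 ^ l * π * t)) with h | h | h <;> simp [h]

lemma measurable_rademacher (l : ℕ) : Measurable (rademacher l) := by
  have hsign : Measurable Real.sign :=
    Measurable.ite measurableSet_Iio measurable_const
      (Measurable.ite measurableSet_Ioi measurable_const measurable_const)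
  exact hsign.comp (by fun_prop)

/-- The Rademacher sum `∑_{l < M} a_{l+1}(t) z_l`. -/
def radSum (M : ℕ) (z : ℕ → ℂ) (t : ℝ) : ℂ :=
  ∑ l ∈ Finset.range M, (rademacher (l + 1) t : ℂ) * z l

lemma measurable_radSum (M : ℕ) (z : ℕ → ℂ) : Measurable (radSum M z) :=
  Finset.measurable_fun_sum _ fun _ _ =>
    (Complex.measurable_ofReal.comp (measurable_rademacher _)).mul_const _

lemma norm_radSum_le (M : ℕ) (z : ℕ → ℂ) (t : ℝ) :
    ‖radSum M z t‖ ≤ ∑ l ∈ Finset.range M, ‖z l‖ := by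
  refine (norm_sum_le _ _).trans (Finset.sum_le_sum fun l _ => ?_)
  rw [norm_mul, Complex.norm_real, Real.norm_eq_abs]
  exact mul_le_of_le_one_left (norm_nonneg _) (abs_rademacher_le_one _ _)

lemma intervalIntegrable_comp_radSum {H : ℂ → ℝ} (hH : Continuous H) (M : ℕ) (z : ℕ → ℂ)
    (a b : ℝ) : IntervalIntegrable (fun t => H (radSum M z t)) volume a b := by
  obtain ⟨K, hK⟩ := (isCompact_closedBall (0 : ℂ)
    (∑ l ∈ Finset.range M, ‖z l‖)).exists_bound_of_continuousOn hH.continuousOn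
  rw [intervalIntegrable_iff]
  refine Measure.integrableOn_of_bounded (M := K) (by simp)
    (hH.measurable.comp (measurable_radSum M z)).aestronglyMeasurable ?_
  exact Filter.Eventually.of_forall fun t => hK _ (by simpa using norm_radSum_le M z t)

lemma radSum_add_one (M : ℕ) (z : ℕ → ℂ) (t : ℝ) : radSum M z (t + 1) = radSum M z t := by
  simp only [radSum, rademacher_succ_add_one]

lemma radSum_succ (M : ℕ) (z : ℕ → ℂ) (t : ℝ) :
    radSum (M + 1) z t = radSum M (fun l => z (l + 1)) (2 * t) + rademacher 1 t * z 0 := by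
  simp only [radSum, Finset.sum_range_succ', rademacher_succ (_ + 1), zero_add]

/-- Conditioning on the first Rademacher function. -/
lemma integral_comp_radSum_succ {H : ℂ → ℝ} (hH : Continuous H) (M : ℕ) (z : ℕ → ℂ) :
    ∫ t in (0 : ℝ)..1, H (radSum (M + 1) z t) =
      ((∫ t in (0 : ℝ)..1, H (radSum M (fun l => z (l + 1)) t + z 0)) +
        ∫ t in (0 : ℝ)..1, H (radSum M (fun l => z (l + 1)) t - z 0)) / 2 := by
  rw [← intervalIntegral.integral_add_adjacent_intervals
    (intervalIntegrable_comp_radSum hH _ z 0 (1 / 2))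
    (intervalIntegrable_comp_radSum hH _ z (1 / 2) 1)]
  have h1 : ∫ t in (0 : ℝ)..(1 / 2), H (radSum (M + 1) z t) =
      ∫ t in (0 : ℝ)..(1 / 2), H (radSum M (fun l => z (l + 1)) (2 * t) + z 0) := by
    refine intervalIntegral.integral_congr_Ioo_of_le (by norm_num) fun t ht => ?_
    simp only [radSum_succ, rademacher_one_of_lt_half ht.1 ht.2, Complex.ofReal_one, one_mul]
  have h2 : ∫ t in (1 / 2 : ℝ)..1, H (radSum (M + 1) z t) =
      ∫ t in (1 / 2 : ℝ)..1, H (radSum M (fun l => z (l + 1)) (2 * t - 1) - z 0) := by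
    refine intervalIntegral.integral_congr_Ioo_of_le (by norm_num) fun t ht => ?_
    have := radSum_add_one M (fun l => z (l + 1)) (2 * t - 1)
    rw [sub_add_cancel] at this
    simp only [radSum_succ, rademacher_one_of_half_lt ht.1 ht.2, this, Complex.ofReal_neg,
      Complex.ofReal_one, neg_mul, one_mul, sub_eq_add_neg]
  rw [h1, h2, intervalIntegral.integral_comp_mul_left
      (fun t => H (radSum M (fun l => z (l + 1)) t + z 0)) two_ne_zero,
    intervalIntegral.integral_comp_mul_sub
      (fun t => H (radSum M (fun l => z (l + 1)) t - z 0)) two_ne_zero]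
  norm_num
  ring

lemma integral_norm_add_radSum_sq (M : ℕ) (z : ℕ → ℂ) (w : ℂ) :
    ∫ t in (0 : ℝ)..1, ‖w + radSum M z t‖ ^ 2 =
      ‖w‖ ^ 2 + ∑ l ∈ Finset.range M, ‖z l‖ ^ 2 := by
  induction M generalizing z w with
  | zero => simp [radSum]
  | succ M ih =>
    rw [integral_comp_radSum_succ (H := fun u => ‖w + u‖ ^ 2) (by fun_prop)]
    have e1 : ∀ u : ℂ, w + (u + z 0) = (w + z 0) + u := fun u => by ring
    have e2 : ∀ u : ℂ, w + (u - z 0) = (w - z 0) + u := fun u => by ring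
    simp only [e1, e2, ih, Finset.sum_range_succ']
    have := parallelogram_law_with_norm ℝ w (z 0)
    linarith

lemma norm_add_pow_four_add_norm_sub_pow_four_le (w z : ℂ) :
    ‖w + z‖ ^ 4 + ‖w - z‖ ^ 4 ≤ 2 * (‖w‖ ^ 4 + 6 * ‖w‖ ^ 2 * ‖z‖ ^ 2 + ‖z‖ ^ 4) := by
  have h : ∀ u : ℂ, ‖u‖ ^ 4 = (‖u‖ ^ 2) ^ 2 := fun u => by ring
  simp only [h, Complex.sq_norm, Complex.normSq_apply, Complex.add_re, Complex.add_im,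
    Complex.sub_re, Complex.sub_im]
  nlinarith [sq_nonneg (w.re * z.im - w.im * z.re)]

lemma integral_norm_add_radSum_pow_four_le (M : ℕ) (z : ℕ → ℂ) (w : ℂ) :
    ∫ t in (0 : ℝ)..1, ‖w + radSum M z t‖ ^ 4 ≤
      ‖w‖ ^ 4 + 6 * ‖w‖ ^ 2 * (∑ l ∈ Finset.range M, ‖z l‖ ^ 2) +
        3 * (∑ l ∈ Finset.range M, ‖z l‖ ^ 2) ^ 2 := by
  induction M generalizing z w with
  | zero => simp [radSum]
  | succ M ih =>
    rw [integral_comp_radSum_succ (H := fun u => ‖w + u‖ ^ 4) (by fun_prop)]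
    have e1 : ∀ u : ℂ, w + (u + z 0) = (w + z 0) + u := fun u => by ring
    have e2 : ∀ u : ℂ, w + (u - z 0) = (w - z 0) + u := fun u => by ring
    simp only [e1, e2, Finset.sum_range_succ']
    have h1 := ih (fun l => z (l + 1)) (w + z 0)
    have h2 := ih (fun l => z (l + 1)) (w - z 0)
    have h3 := parallelogram_law_with_norm ℝ w (z 0)
    have h4 := norm_add_pow_four_add_norm_sub_pow_four_le w (z 0)
    set s := ∑ l ∈ Finset.range M, ‖z (l + 1)‖ ^ 2
    have h5 : (‖w + z 0‖ ^ 2 + ‖w - z 0‖ ^ 2) * s = 2 * (‖w‖ ^ 2 + ‖z 0‖ ^ 2) * s := by rw [h3]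
    nlinarith [sq_nonneg (‖z 0‖ ^ 2)]

/-- The upper half of Khintchine's inequality in `L¹`. -/
lemma integral_norm_radSum_le (M : ℕ) (z : ℕ → ℂ) :
    ∫ t in (0 : ℝ)..1, ‖radSum M z t‖ ≤ √(∑ l ∈ Finset.range M, ‖z l‖ ^ 2) := by
  set s := ∑ l ∈ Finset.range M, ‖z l‖ ^ 2
  have h2 : ∫ t in (0 : ℝ)..1, ‖radSum M z t‖ ^ 2 = s := by
    simpa using integral_norm_add_radSum_sq M z 0
  have hInt := fun (p : ℕ) => intervalIntegrable_comp_radSum (H := fun u => ‖u‖ ^ p)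
    (by fun_prop) M z 0 1
  refine Real.le_sqrt_of_sq_le ?_
  set I := ∫ t in (0 : ℝ)..1, ‖radSum M z t‖ with hI
  have key : ∫ t in (0 : ℝ)..1, (2 * I * ‖radSum M z t‖ ^ 1 - I ^ 2) ≤
      ∫ t in (0 : ℝ)..1, ‖radSum M z t‖ ^ 2 := by
    refine intervalIntegral.integral_mono_on zero_le_one
      (((hInt 1).const_mul _).sub intervalIntegrable_const) (hInt 2) fun t _ => ?_
    nlinarith [sq_nonneg (‖radSum M z t‖ - I)]
  rw [intervalIntegral.integral_sub ((hInt 1).const_mul _) intervalIntegrable_const,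
    intervalIntegral.integral_const_mul, h2] at key
  simp only [pow_one, ← hI, intervalIntegral.integral_const, smul_eq_mul] at key
  linarith

/-- The lower half of Khintchine's inequality in `L¹`. -/
lemma le_integral_norm_radSum (M : ℕ) (z : ℕ → ℂ) :
    1 / 2 * √(∑ l ∈ Finset.range M, ‖z l‖ ^ 2) ≤ ∫ t in (0 : ℝ)..1, ‖radSum M z t‖ := by
  set s := ∑ l ∈ Finset.range M, ‖z l‖ ^ 2
  have hs0 : 0 ≤ s := Finset.sum_nonneg fun _ _ => by positivity
  rcases hs0.eq_or_lt with h0 | hpos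
  · rw [← h0, Real.sqrt_zero, mul_zero]
    exact intervalIntegral.integral_nonneg zero_le_one fun _ _ => norm_nonneg _
  have h2 : ∫ t in (0 : ℝ)..1, ‖radSum M z t‖ ^ 2 = s := by
    simpa using integral_norm_add_radSum_sq M z 0
  have h4 : ∫ t in (0 : ℝ)..1, ‖radSum M z t‖ ^ 4 ≤ 3 * s ^ 2 := by
    simpa using integral_norm_add_radSum_pow_four_le M z 0
  have hInt := fun (p : ℕ) => intervalIntegrable_comp_radSum (H := fun u => ‖u‖ ^ p)
    (by fun_prop) M z 0 1
  have hr : 0 < √s := Real.sqrt_pos.2 hpos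
  have hrs : √s ^ 2 = s := Real.sq_sqrt hs0
  set r := √s
  -- `y ≥ (3 y² - y⁴) / 2` for `y ≥ 0`, applied with `y = ‖radSum M z t‖ / (2 * r)`.
  have key : ∫ t in (0 : ℝ)..1,
      (3 / (4 * r) * ‖radSum M z t‖ ^ 2 - 1 / (16 * r ^ 3) * ‖radSum M z t‖ ^ 4) ≤
      ∫ t in (0 : ℝ)..1, ‖radSum M z t‖ ^ 1 := by
    refine intervalIntegral.integral_mono_on zero_le_one
      (((hInt 2).const_mul _).sub ((hInt 4).const_mul _)) (hInt 1) fun t _ => ?_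
    obtain ⟨y, hy⟩ : ∃ y, ‖radSum M z t‖ = 2 * r * y :=
      ⟨‖radSum M z t‖ / (2 * r), by field_simp⟩
    have hy0 : 0 ≤ y := by
      have : 0 ≤ 2 * r * y := hy ▸ norm_nonneg _
      exact nonneg_of_mul_nonneg_right this (by positivity)
    rw [hy]
    have e : 3 / (4 * r) * (2 * r * y) ^ 2 - 1 / (16 * r ^ 3) * (2 * r * y) ^ 4 =
        2 * r * ((3 * y ^ 2 - y ^ 4) / 2) := by
      field_simp
      ring
    rw [e, pow_one]
    gcongr
    nlinarith [mul_nonneg (mul_nonneg hy0 (sq_nonneg (y - 1))) (by linarith : 0 ≤ y + 2)]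
  rw [intervalIntegral.integral_sub ((hInt 2).const_mul _) ((hInt 4).const_mul _),
    intervalIntegral.integral_const_mul, intervalIntegral.integral_const_mul, h2] at key
  simp only [pow_one] at key
  refine le_trans ?_ key
  have h5 : 1 / (16 * r ^ 3) * ∫ t in (0 : ℝ)..1, ‖radSum M z t‖ ^ 4 ≤
      1 / (16 * r ^ 3) * (3 * s ^ 2) := by gcongr
  have h6 : 3 / (4 * r) * s - 1 / (16 * r ^ 3) * (3 * s ^ 2) = 9 / 16 * r := by
    rw [← hrs]
    field_simp
    ring
  linarith

lemma lintegral_enorm_radSum (M : ℕ) (z : ℕ → ℂ) :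
    ∫⁻ t in Icc (0 : ℝ) 1, ‖radSum M z t‖ₑ =
      ENNReal.ofReal (∫ t in (0 : ℝ)..1, ‖radSum M z t‖) := by
  have hInt := intervalIntegrable_comp_radSum (H := fun u => ‖u‖) (by fun_prop) M z 0 1
  rw [intervalIntegrable_iff_integrableOn_Ioc_of_le zero_le_one] at hInt
  rw [intervalIntegral.integral_of_le zero_le_one, ofReal_integral_eq_lintegral_ofReal hInt
    (Filter.Eventually.of_forall fun _ => norm_nonneg _), restrict_Ioc_eq_restrict_Icc]
  simp only [ofReal_norm]

/-- The translated tensor product `ξ ↦ ∏ r, φ̂ (ξ r - v r)`. -/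
def modFourier {n : ℕ} (φ : SchwartzMap ℝ ℂ) (v : Fin n → ℝ) (ξ : Rn n) : ℂ :=
  ∏ r, 𝓕 (⇑φ) (ξ r - v r)

lemma integrable_fourier_schwartz (φ : SchwartzMap ℝ ℂ) : Integrable (𝓕 (⇑φ)) :=
  (𝓕 φ).integrable

lemma norm_exp_two_pi_I_mul (y : ℝ) : ‖Complex.exp (2 * π * I * (y : ℂ))‖ = 1 := by
  rw [show 2 * π * I * (y : ℂ) = ((2 * π * y : ℝ) : ℂ) * I by push_cast; ring,
    Complex.norm_exp_ofReal_mul_I]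

lemma integral_fourier_sub_mul_exp (φ : SchwartzMap ℝ ℂ) (v y : ℝ) :
    ∫ s : ℝ, 𝓕 (⇑φ) (s - v) * Complex.exp (2 * π * I * ((y * s : ℝ) : ℂ)) =
      Complex.exp (2 * π * I * ((y * v : ℝ) : ℂ)) * φ y := by
  have hinv : 𝓕⁻ (𝓕 (⇑φ)) y = φ y :=
    congrFun (φ.continuous.fourierInv_fourier_eq φ.integrable (integrable_fourier_schwartz φ)) y
  rw [← integral_add_right_eq_self _ v, ← hinv, Real.fourierInv_eq', ← integral_const_mul]
  refine integral_congr_ae (Filter.Eventually.of_forall fun s => ?_)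
  simp only [add_sub_cancel_right, smul_eq_mul, RCLike.inner_apply, conj_trivial]
  rw [← mul_assoc, ← Complex.exp_add, mul_comm]
  congr 2
  push_cast
  ring

lemma integrable_fourier_sub_mul_exp (φ : SchwartzMap ℝ ℂ) (v y : ℝ) :
    Integrable fun s : ℝ => 𝓕 (⇑φ) (s - v) * Complex.exp (2 * π * I * ((y * s : ℝ) : ℂ)) := by
  refine ((integrable_fourier_schwartz φ).comp_sub_right v).mul_bdd (c := 1)
    (by fun_prop) (Filter.Eventually.of_forall fun s => (norm_exp_two_pi_I_mul (y * s)).le)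

lemma modFourier_mul_exp {n : ℕ} (φ : SchwartzMap ℝ ℂ) (v : Fin n → ℝ) (x ξ : Rn n) :
    modFourier φ v ξ * Complex.exp (2 * π * I * ((⟪x, ξ⟫ : ℝ) : ℂ)) =
      ∏ r, (𝓕 (⇑φ) (ξ r - v r) * Complex.exp (2 * π * I * ((x r * ξ r : ℝ) : ℂ))) := by
  rw [Finset.prod_mul_distrib, modFourier, ← Complex.exp_sum, ← Finset.mul_sum,
    ← Complex.ofReal_sum]
  simp [PiLp.inner_apply, mul_comm]

lemma integrable_modFourier_mul_exp {n : ℕ} (φ : SchwartzMap ℝ ℂ) (v : Fin n → ℝ) (x : Rn n) :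
    Integrable fun ξ : Rn n =>
      modFourier φ v ξ * Complex.exp (2 * π * I * ((⟪x, ξ⟫ : ℝ) : ℂ)) := by
  simp only [modFourier_mul_exp]
  exact (PiLp.volume_preserving_ofLp (Fin n)).integrable_comp_of_integrable
    (Integrable.fintype_prod (f := fun r s =>
      𝓕 (⇑φ) (s - v r) * Complex.exp (2 * π * I * ((x r * s : ℝ) : ℂ)))
      fun r => integrable_fourier_sub_mul_exp φ (v r) (x r))

lemma integral_euclidean_prod {𝕜 : Type*} [RCLike 𝕜] {n : ℕ} (F : Fin n → ℝ → 𝕜) :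
    ∫ ξ : Rn n, ∏ r, F r (ξ r) = ∏ r, ∫ s, F r s := by
  rw [← integral_fintype_prod_volume_eq_prod]
  exact (PiLp.volume_preserving_ofLp (Fin n)).integral_comp
    (MeasurableEquiv.toLp 2 (Fin n → ℝ)).symm.measurableEmbedding (fun y => ∏ r, F r (y r))

lemma integral_modFourier_mul_exp {n : ℕ} (φ : SchwartzMap ℝ ℂ) (v : Fin n → ℝ) (x : Rn n) :
    ∫ ξ : Rn n, modFourier φ v ξ * Complex.exp (2 * π * I * ((⟪x, ξ⟫ : ℝ) : ℂ)) =
      Complex.exp (2 * π * I * ((∑ r, x r * v r : ℝ) : ℂ)) * ∏ r, φ (x r) := by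
  simp only [modFourier_mul_exp]
  rw [integral_euclidean_prod (fun r s =>
    𝓕 (⇑φ) (s - v r) * Complex.exp (2 * π * I * ((x r * s : ℝ) : ℂ)))]
  simp only [integral_fourier_sub_mul_exp, Finset.prod_mul_distrib]
  rw [← Complex.exp_sum, ← Finset.mul_sum, ← Complex.ofReal_sum]

/-- The bilinear operator on a finite sum of tensors. -/
lemma biOp_eq_sum {n : ℕ} (φ : SchwartzMap ℝ ℂ) (σ : Rn n × Rn n → ℂ)
    (f g : SchwartzMap (Rn n) ℂ) {ι : Type*} (s : Finset ι) (v w : ι → Fin n → ℝ) (α : ι → ℂ)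
    (h : ∀ ξ η, σ (ξ, η) * 𝓕 (⇑f) ξ * 𝓕 (⇑g) η =
      ∑ i ∈ s, α i * (modFourier φ (v i) ξ * modFourier φ (w i) η)) (x : Rn n) :
    biOp σ f g x = (∏ r, φ (x r)) ^ 2 *
      ∑ i ∈ s, α i * Complex.exp (2 * π * I * ((∑ r, x r * (v i r + w i r) : ℝ) : ℂ)) := by
  have hpt : ∀ ξ η, σ (ξ, η) * 𝓕 (⇑f) ξ * 𝓕 (⇑g) η *
      Complex.exp (2 * π * I * ((⟪x, ξ + η⟫ : ℝ) : ℂ)) =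
      ∑ i ∈ s, (α i * (modFourier φ (v i) ξ * Complex.exp (2 * π * I * ((⟪x, ξ⟫ : ℝ) : ℂ)))) *
        (modFourier φ (w i) η * Complex.exp (2 * π * I * ((⟪x, η⟫ : ℝ) : ℂ))) := by
    intro ξ η
    rw [h, Finset.sum_mul, inner_add_right, Complex.ofReal_add, mul_add, Complex.exp_add]
    exact Finset.sum_congr rfl fun i _ => by ring
  simp only [biOp, hpt]
  have hη : ∀ ξ : Rn n, ∫ η : Rn n, ∑ i ∈ s,
      (α i * (modFourier φ (v i) ξ * Complex.exp (2 * π * I * ((⟪x, ξ⟫ : ℝ) : ℂ)))) *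
        (modFourier φ (w i) η * Complex.exp (2 * π * I * ((⟪x, η⟫ : ℝ) : ℂ))) =
      ∑ i ∈ s, (α i * (modFourier φ (v i) ξ * Complex.exp (2 * π * I * ((⟪x, ξ⟫ : ℝ) : ℂ)))) *
        (Complex.exp (2 * π * I * ((∑ r, x r * w i r : ℝ) : ℂ)) * ∏ r, φ (x r)) := by
    intro ξ
    rw [integral_finsetSum _ fun i _ => (integrable_modFourier_mul_exp φ (w i) x).const_mul _]
    simp only [integral_const_mul, integral_modFourier_mul_exp]
  simp only [hη]
  rw [integral_finsetSum _ fun i _ =>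
    ((integrable_modFourier_mul_exp φ (v i) x).const_mul _).mul_const _, Finset.mul_sum]
  refine Finset.sum_congr rfl fun i _ => ?_
  rw [integral_mul_const, integral_const_mul, integral_modFourier_mul_exp]
  simp only [mul_add (x _), Finset.sum_add_distrib, Complex.ofReal_add]
  rw [mul_add, Complex.exp_add]
  ring

lemma lintegral_prod_norm_sq {n : ℕ} (φ : SchwartzMap ℝ ℂ) :
    ∫⁻ x : Rn n, ‖(∏ r, φ (x r)) ^ 2‖ₑ = ENNReal.ofReal ((∫ y : ℝ, ‖φ y‖ ^ 2) ^ n) := by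
  have hφ : Integrable fun y => ‖φ y‖ ^ 2 := (φ.memLp 2).integrable_norm_pow two_ne_zero
  have hInt : Integrable fun x : Rn n => ∏ r, ‖φ (x r)‖ ^ 2 :=
    (PiLp.volume_preserving_ofLp (Fin n)).integrable_comp_of_integrable
      (Integrable.fintype_prod (f := fun _ y => ‖φ y‖ ^ 2) fun _ => hφ)
  have h := integral_euclidean_prod (n := n) (fun _ y => ‖φ y‖ ^ 2)
  rw [Finset.prod_const, Finset.card_univ, Fintype.card_fin] at h
  rw [← h, ofReal_integral_eq_lintegral_ofReal hInt
    (Filter.Eventually.of_forall fun x => by positivity)]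
  refine lintegral_congr fun x => ?_
  rw [← ofReal_norm, norm_pow, norm_prod, Finset.prod_pow]

/-- The frequency shift `(j + 1, 1, …, 1)`, with the entry `j + 1` at the index `i`. -/
def freqShift {n : ℕ} (i : Fin n) (j : ℕ) (r : Fin n) : ℝ := if r = i then (j : ℝ) + 1 else 1

lemma prod_sub_freqShift {M : Type*} [CommMonoid M] {n : ℕ} (i : Fin n) (h : ℝ → M) (j : ℕ)
    (ξ : Rn n) :
    ∏ r, h (ξ r - freqShift i j r) =
      h (ξ i - ((j : ℝ) + 1)) * ∏ r, (if r = i then 1 else h (ξ r - 1)) := by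
  rw [← Fintype.prod_ite_eq' i fun r => h (ξ r - ((j : ℝ) + 1)), ← Finset.prod_mul_distrib]
  refine Finset.prod_congr rfl fun r _ => ?_
  by_cases hr : r = i <;> simp [freqShift, hr]

lemma prod_bump_eq_ite {n : ℕ} (i : Fin n) {φ : SchwartzMap ℝ ℂ}
    (hφ : Function.support (𝓕 (⇑φ)) ⊆ Icc (-(1 / 100) : ℝ) (1 / 100)) {ψ : ℝ → ℝ}
    (hψ : Function.support ψ ⊆ Icc (-(1 / 10) : ℝ) (1 / 10))
    (hψ1 : ∀ y ∈ Icc (-(1 / 20) : ℝ) (1 / 20), ψ y = 1) {j : ℕ} {ξ : Rn n}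
    (h : modFourier φ (freqShift i j) ξ ≠ 0) (j' : ℕ) :
    ∏ r, ψ (ξ r - freqShift i j' r) = if j' = j then 1 else 0 := by
  have hmem : ∀ r, ξ r - freqShift i j r ∈ Icc (-(1 / 100) : ℝ) (1 / 100) := fun r =>
    hφ (Finset.prod_ne_zero_iff.1 h r (Finset.mem_univ r))
  split_ifs with hj
  · subst hj
    refine Finset.prod_eq_one fun r _ => hψ1 _ ⟨?_, ?_⟩ <;>
      linarith [(hmem r).1, (hmem r).2]
  · refine Finset.prod_eq_zero (Finset.mem_univ i) (by_contra fun hne => ?_)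
    have h1 := hψ hne
    have h2 := hmem i
    simp only [freqShift, if_true, mem_Icc] at h1 h2
    rcases Nat.lt_or_gt_of_ne hj with hlt | hlt
    · have : (j' : ℝ) + 1 ≤ j := by exact_mod_cast hlt
      linarith
    · have : (j : ℝ) + 1 ≤ j' := by exact_mod_cast hlt
      linarith

/-- On the support of a translated tensor, the randomized symbol is a single coefficient. -/
lemma symbol_mul_modFourier {n : ℕ} (i : Fin n) {φ : SchwartzMap ℝ ℂ}
    (hφ : Function.support (𝓕 (⇑φ)) ⊆ Icc (-(1 / 100) : ℝ) (1 / 100)) {ψ : ℝ → ℝ}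
    (hψ : Function.support ψ ⊆ Icc (-(1 / 10) : ℝ) (1 / 10))
    (hψ1 : ∀ y ∈ Icc (-(1 / 20) : ℝ) (1 / 20), ψ y = 1) (A : ℕ → ℕ → ℝ) (j k : ℕ) (ξ η : Rn n) :
    ((∑' j : ℕ, ∑' k : ℕ, A j k * (ψ (ξ i - ((j : ℝ) + 1)) * ψ (η i - ((k : ℝ) + 1))) *
        ∏ r : Fin n, (if r = i then 1 else ψ (ξ r - 1) * ψ (η r - 1)) : ℝ) : ℂ) *
      (modFourier φ (freqShift i j) ξ * modFourier φ (freqShift i k) η) =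
      A j k * (modFourier φ (freqShift i j) ξ * modFourier φ (freqShift i k) η) := by
  by_cases hξ : modFourier φ (freqShift i j) ξ = 0
  · simp [hξ]
  by_cases hη : modFourier φ (freqShift i k) η = 0
  · simp [hη]
  congr 2
  have hterm : ∀ j' k' : ℕ,
      A j' k' * (ψ (ξ i - ((j' : ℝ) + 1)) * ψ (η i - ((k' : ℝ) + 1))) *
        ∏ r : Fin n, (if r = i then 1 else ψ (ξ r - 1) * ψ (η r - 1)) =
      A j' k' * ((if j' = j then 1 else 0) * (if k' = k then 1 else 0)) := by
    intro j' k'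
    rw [← prod_bump_eq_ite i hφ hψ hψ1 hξ j', ← prod_bump_eq_ite i hφ hψ hψ1 hη k',
      prod_sub_freqShift, prod_sub_freqShift]
    have : ∏ r : Fin n, (if r = i then 1 else ψ (ξ r - 1) * ψ (η r - 1)) =
        (∏ r, (if r = i then 1 else ψ (ξ r - 1))) * ∏ r, (if r = i then 1 else ψ (η r - 1)) := by
      rw [← Finset.prod_mul_distrib]
      exact Finset.prod_congr rfl fun r _ => by split_ifs <;> simp
    rw [this]
    ring
  simp only [hterm]
  rw [tsum_eq_single j fun j' hj => by simp [hj], tsum_eq_single k fun k' hk => by simp [hk]]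
  simp

/-- The convolution coefficients `∑_{j=1}^{l+1} b_j d_{l+2-j}`. -/
def convCoeff (b d : ℕ → ℝ) (l : ℕ) : ℝ := ∑ j ∈ Finset.Ico 1 (l + 2), b j * d (l + 2 - j)

lemma convCoeff_eq_sum_antidiagonal (b d : ℕ → ℝ) (l : ℕ) :
    convCoeff b d l = ∑ p ∈ Finset.HasAntidiagonal.antidiagonal l, b (p.1 + 1) * d (p.2 + 1) := by
  rw [Finset.Nat.sum_antidiagonal_eq_sum_range_succ (fun j k => b (j + 1) * d (k + 1)),
    convCoeff, Finset.sum_Ico_eq_sum_range]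
  refine Finset.sum_congr (by simp) fun j hj => ?_
  rw [Finset.mem_range] at hj
  rw [add_comm 1 j, show l + 2 - (j + 1) = l - j + 1 by omega]

lemma convCoeff_eq_zero {b d : ℕ → ℝ} {N : ℕ} (hb : ∀ j, N ≤ j → b (j + 1) = 0)
    (hd : ∀ j, N ≤ j → d (j + 1) = 0) {l : ℕ} (hl : 2 * N ≤ l) : convCoeff b d l = 0 := by
  rw [convCoeff_eq_sum_antidiagonal]
  refine Finset.sum_eq_zero fun p hp => ?_
  rw [Finset.HasAntidiagonal.mem_antidiagonal] at hp
  rcases le_or_gt N p.1 with h | h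
  · simp [hb _ h]
  · simp [hd p.2 (by omega)]

lemma sum_product_eq_sum_convCoeff {b d : ℕ → ℝ} {N : ℕ} (hb : ∀ j, N ≤ j → b (j + 1) = 0)
    (hd : ∀ j, N ≤ j → d (j + 1) = 0) (F : ℕ → ℂ) :
    ∑ p ∈ Finset.range N ×ˢ Finset.range N, F (p.1 + p.2) * (b (p.1 + 1) * d (p.2 + 1)) =
      ∑ l ∈ Finset.range (2 * N), F l * convCoeff b d l := by
  rw [← Finset.sum_fiberwise_of_maps_to (t := Finset.range (2 * N)) (g := fun p => p.1 + p.2)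
    fun p hp => by simp only [Finset.mem_product, Finset.mem_range] at hp ⊢; omega]
  refine Finset.sum_congr rfl fun l _ => ?_
  rw [convCoeff_eq_sum_antidiagonal, Complex.ofReal_sum, Finset.mul_sum]
  refine (Finset.sum_congr rfl fun p hp => ?_).trans
    (Finset.sum_subset (s₁ := (Finset.range N ×ˢ Finset.range N).filter fun p => p.1 + p.2 = l)
      (fun p hp => ?_) fun p hp hp' => ?_)
  · rw [(Finset.mem_filter.1 hp).2, Complex.ofReal_mul]
  · exact Finset.HasAntidiagonal.mem_antidiagonal.2 (Finset.mem_filter.1 hp).2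
  · simp only [Finset.mem_filter, Finset.mem_product, Finset.mem_range,
      Finset.HasAntidiagonal.mem_antidiagonal.1 hp, and_true, not_and_or, not_lt] at hp'
    rcases hp' with h | h
    · simp [hb _ h]
    · simp [hd _ h]

/-- The coefficients of the Rademacher sum that represents the operator at the point `y`. -/
def radCoeff (b d cc : ℕ → ℝ) (y : ℝ) : ℕ → ℂ
  | 0 => 0
  | l + 1 => (cc (l + 2) * convCoeff b d l : ℝ) *
      Complex.exp (2 * π * I * ((y * (l + 2) : ℝ) : ℂ))

lemma sum_norm_radCoeff_sq (b d cc : ℕ → ℝ) (y : ℝ) (M : ℕ) :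
    ∑ l ∈ Finset.range (M + 1), ‖radCoeff b d cc y l‖ ^ 2 =
      ∑ l ∈ Finset.range M, cc (l + 2) ^ 2 * convCoeff b d l ^ 2 := by
  rw [Finset.sum_range_succ']
  simp only [radCoeff, norm_mul, norm_exp_two_pi_I_mul, Complex.norm_real, Real.norm_eq_abs,
    mul_one, sq_abs, mul_pow, norm_zero, ne_eq, OfNat.ofNat_ne_zero, not_false_eq_true, zero_pow,
    add_zero]

lemma continuous_radCoeff (b d cc : ℕ → ℝ) (l : ℕ) : Continuous fun y => radCoeff b d cc y l := by
  cases l with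
  | zero => exact continuous_const
  | succ l =>
    simp only [radCoeff]
    fun_prop

lemma fourier_eq_sum_modFourier {n : ℕ} (i : Fin n) {φ : SchwartzMap ℝ ℂ} {b : ℕ → ℝ} {N : ℕ}
    (hb : ∀ j, N ≤ j → b (j + 1) = 0) (ξ : Rn n) :
    ∑' j : ℕ, ((b (j + 1) : ℝ) : ℂ) * 𝓕 (⇑φ) (ξ i - ((j : ℝ) + 1)) *
        ∏ r : Fin n, (if r = i then 1 else 𝓕 (⇑φ) (ξ r - 1)) =
      ∑ j ∈ Finset.range N, (b (j + 1) : ℂ) * modFourier φ (freqShift i j) ξ := by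
  rw [tsum_eq_sum (s := Finset.range N)
    fun j hj => by simp [hb j (by simpa using hj)]]
  refine Finset.sum_congr rfl fun j _ => ?_
  rw [modFourier, prod_sub_freqShift, mul_assoc]

lemma exists_bound_of_finite_support {b : ℕ → ℝ} (hb : (Function.support b).Finite) :
    ∃ N, ∀ j, N ≤ j → b (j + 1) = 0 := by
  obtain ⟨N, hN⟩ := hb.bddAbove
  exact ⟨N, fun j hj => by_contra fun h => by have := hN h; omega⟩

lemma enorm_biOp_eq {n : ℕ} (i : Fin n) {φ : SchwartzMap ℝ ℂ}
    (hφ : Function.support (𝓕 (⇑φ)) ⊆ Icc (-(1 / 100) : ℝ) (1 / 100)) {ψ : ℝ → ℝ}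
    (hψ : Function.support ψ ⊆ Icc (-(1 / 10) : ℝ) (1 / 10))
    (hψ1 : ∀ y ∈ Icc (-(1 / 20) : ℝ) (1 / 20), ψ y = 1) {b d : ℕ → ℝ} (cc : ℕ → ℝ) {N : ℕ}
    (hb : ∀ j, N ≤ j → b (j + 1) = 0) (hd : ∀ j, N ≤ j → d (j + 1) = 0)
    {f g : SchwartzMap (Rn n) ℂ}
    (hf : ∀ ξ : Rn n, 𝓕 (⇑f) ξ =
      ∑' j : ℕ, ((b (j + 1) : ℝ) : ℂ) * 𝓕 (⇑φ) (ξ i - ((j : ℝ) + 1)) *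
        ∏ r : Fin n, (if r = i then 1 else 𝓕 (⇑φ) (ξ r - 1)))
    (hg : ∀ η : Rn n, 𝓕 (⇑g) η =
      ∑' k : ℕ, ((d (k + 1) : ℝ) : ℂ) * 𝓕 (⇑φ) (η i - ((k : ℝ) + 1)) *
        ∏ r : Fin n, (if r = i then 1 else 𝓕 (⇑φ) (η r - 1)))
    (t : ℝ) (x : Rn n) :
    ‖biOp (fun p : Rn n × Rn n => ((∑' j : ℕ, ∑' k : ℕ,
        rademacher (j + k + 2) t * cc (j + k + 2) *
          (ψ (p.1 i - ((j : ℝ) + 1)) * ψ (p.2 i - ((k : ℝ) + 1))) *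
          ∏ r : Fin n, (if r = i then 1 else ψ (p.1 r - 1) * ψ (p.2 r - 1)) : ℝ) : ℂ)) f g x‖ₑ =
      ‖(∏ r, φ (x r)) ^ 2‖ₑ * ‖radSum (2 * N + 1) (radCoeff b d cc (x i)) t‖ₑ := by
  rw [biOp_eq_sum φ _ f g (Finset.range N ×ˢ Finset.range N) (fun p => freqShift i p.1)
    (fun p => freqShift i p.2)
    (fun p => ((rademacher (p.1 + p.2 + 2) t * cc (p.1 + p.2 + 2) : ℝ) : ℂ) *
      (b (p.1 + 1) * d (p.2 + 1)))]
  · have hphase : ∀ j k : ℕ,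
        Complex.exp (2 * π * I * ((∑ r, x r * (freqShift i j r + freqShift i k r) : ℝ) : ℂ)) =
        Complex.exp (2 * π * I * ((x i * (((j + k : ℕ) : ℝ) + 2) : ℝ) : ℂ)) *
          Complex.exp (2 * π * I * ((∑ r, if r = i then 0 else 2 * x r : ℝ) : ℂ)) := by
      intro j k
      rw [← Complex.exp_add, ← mul_add, ← Complex.ofReal_add,
        ← Fintype.sum_ite_eq' i fun r => x r * (((j + k : ℕ) : ℝ) + 2), ← Finset.sum_add_distrib]
      congr 3
      refine Finset.sum_congr rfl fun r _ => ?_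
      by_cases hr : r = i
      · simp only [freqShift, hr, if_true]
        push_cast
        ring
      · simp only [freqShift, hr, if_false]
        ring
    have hsum := sum_product_eq_sum_convCoeff hb hd fun l =>
      ((rademacher (l + 2) t * cc (l + 2) : ℝ) : ℂ) *
        Complex.exp (2 * π * I * ((x i * ((l : ℝ) + 2) : ℝ) : ℂ))
    have hrad : radSum (2 * N + 1) (radCoeff b d cc (x i)) t =
        ∑ l ∈ Finset.range (2 * N), ((rademacher (l + 2) t * cc (l + 2) : ℝ) : ℂ) *
          Complex.exp (2 * π * I * ((x i * ((l : ℝ) + 2) : ℝ) : ℂ)) * convCoeff b d l := by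
      rw [radSum, Finset.sum_range_succ']
      simp only [radCoeff, mul_zero, add_zero]
      refine Finset.sum_congr rfl fun l _ => ?_
      push_cast
      ring
    have hunit :
        ‖Complex.exp (2 * π * I * ((∑ r, if r = i then 0 else 2 * x r : ℝ) : ℂ))‖ₑ = 1 := by
      rw [← ofReal_norm, norm_exp_two_pi_I_mul, ENNReal.ofReal_one]
    rw [enorm_mul, ← one_mul ‖radSum _ _ _‖ₑ, ← hunit, ← enorm_mul (Complex.exp _), hrad, ← hsum]
    congr 2
    rw [Finset.mul_sum]
    refine Finset.sum_congr rfl fun p _ => ?_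
    rw [hphase]
    ring
  · intro ξ η
    rw [hf, hg, fourier_eq_sum_modFourier i hb, fourier_eq_sum_modFourier i hd, mul_assoc,
      Finset.sum_mul_sum, Finset.sum_product, Finset.mul_sum]
    refine Finset.sum_congr rfl fun j _ => ?_
    rw [Finset.mul_sum]
    refine Finset.sum_congr rfl fun k _ => ?_
    have := symbol_mul_modFourier i hφ hψ hψ1
      (fun j k => rademacher (j + k + 2) t * cc (j + k + 2)) j k ξ η
    linear_combination (b (j + 1) * d (k + 1) : ℂ) * this

lemma lintegral_enorm_mul_radSum {n : ℕ} (i : Fin n) (φ : SchwartzMap ℝ ℂ) (b d cc : ℕ → ℝ)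
    (M : ℕ) :
    ∫⁻ t in Icc (0 : ℝ) 1, ∫⁻ x : Rn n,
        ‖(∏ r, φ (x r)) ^ 2‖ₑ * ‖radSum M (radCoeff b d cc (x i)) t‖ₑ =
      ∫⁻ x : Rn n, ‖(∏ r, φ (x r)) ^ 2‖ₑ *
        ∫⁻ t in Icc (0 : ℝ) 1, ‖radSum M (radCoeff b d cc (x i)) t‖ₑ := by
  have hφ : Continuous fun x : Rn n => (∏ r, φ (x r)) ^ 2 := by
    have := φ.continuous
    fun_prop
  have hrad : Measurable fun q : ℝ × Rn n => radSum M (radCoeff b d cc (q.2 i)) q.1 := by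
    refine Finset.measurable_fun_sum _ fun l _ => Measurable.mul ?_ ?_
    · exact Complex.measurable_ofReal.comp ((measurable_rademacher _).comp measurable_fst)
    · exact ((continuous_radCoeff b d cc l).comp
        (by fun_prop : Continuous fun x : Rn n => x i)).measurable.comp measurable_snd
  rw [lintegral_lintegral_swap
    (((hφ.measurable.comp measurable_snd).enorm.mul hrad.enorm).aemeasurable)]
  refine lintegral_congr fun x => lintegral_const_mul _ ?_
  exact (measurable_radSum _ _).enorm

/-- The Khintchine-type identity in the necessity part of the proof of
Theorem 2 of Grafakos–He–Slavíková: with `f̂, ĝ` lacunary sums built from a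
Schwartz function `φ` with `supp φ̂ ⊆ [-1/100, 1/100]`, and with the randomized
multipliers `m_t` built from a bump `ψ` and the coefficients `c_l`, one has
`∫_0^1 ‖T_{m_t}(f,g)‖_{L^1} dt ≈ (Σ_{l≥2} c_l² (Σ_{j=1}^{l-1} b_j d_{l-j})²)^{1/2} (∫|φ|²)^n`
with absolute implicit constants. -/
theorem statement17 :
    ∃ c C : ℝ, 0 < c ∧ c ≤ C ∧
      ∀ (n : ℕ) (hn : 0 < n) (φ : SchwartzMap ℝ ℂ),
        (Function.support (𝓕 (⇑φ)) ⊆ Icc (-(1 / 100) : ℝ) (1 / 100)) →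
        ∀ ψ : ℝ → ℝ, ContDiff ℝ (⊤ : ℕ∞) ψ →
          (Function.support ψ ⊆ Icc (-(1 / 10) : ℝ) (1 / 10)) →
          (∀ y ∈ Icc (-(1 / 20) : ℝ) (1 / 20), ψ y = 1) →
          ∀ b d cc : ℕ → ℝ,
            (∀ j, 0 ≤ b j) → (∀ j, 0 ≤ d j) → (∀ l, 0 ≤ cc l) →
            b 0 = 0 → d 0 = 0 →
            (Function.support b).Finite → (Function.support d).Finite →
            (∃ B : ℝ, ∀ l, cc l ≤ B) →
            ∀ f g : SchwartzMap (Rn n) ℂ,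
              (∀ ξ : Rn n, 𝓕 (⇑f) ξ =
                ∑' j : ℕ, ((b (j + 1) : ℝ) : ℂ) *
                  𝓕 (⇑φ) (ξ ⟨0, hn⟩ - ((j : ℝ) + 1)) *
                  ∏ r : Fin n, (if r = ⟨0, hn⟩ then 1 else 𝓕 (⇑φ) (ξ r - 1))) →
              (∀ η : Rn n, 𝓕 (⇑g) η =
                ∑' k : ℕ, ((d (k + 1) : ℝ) : ℂ) *
                  𝓕 (⇑φ) (η ⟨0, hn⟩ - ((k : ℝ) + 1)) *
                  ∏ r : Fin n, (if r = ⟨0, hn⟩ then 1 else 𝓕 (⇑φ) (η r - 1))) →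
              ENNReal.ofReal
                  (c * (Real.sqrt (∑' l : ℕ, (cc (l + 2)) ^ 2 *
                      (∑ j ∈ Finset.Ico 1 (l + 2), b j * d (l + 2 - j)) ^ 2) *
                    (∫ y : ℝ, ‖φ y‖ ^ 2) ^ n))
                ≤ ∫⁻ t in Icc (0 : ℝ) 1,
                    eLpNorm
                      (biOp (fun p : Rn n × Rn n =>
                        ((∑' j : ℕ, ∑' k : ℕ,
                          rademacher (j + k + 2) t * cc (j + k + 2) *
                            (ψ (p.1 ⟨0, hn⟩ - ((j : ℝ) + 1)) *
                              ψ (p.2 ⟨0, hn⟩ - ((k : ℝ) + 1))) *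
                            ∏ r : Fin n,
                              (if r = ⟨0, hn⟩ then 1
                               else ψ (p.1 r - 1) * ψ (p.2 r - 1)) : ℝ) : ℂ)) f g)
                      1 volume ∧
              (∫⁻ t in Icc (0 : ℝ) 1,
                    eLpNorm
                      (biOp (fun p : Rn n × Rn n =>
                        ((∑' j : ℕ, ∑' k : ℕ,
                          rademacher (j + k + 2) t * cc (j + k + 2) *
                            (ψ (p.1 ⟨0, hn⟩ - ((j : ℝ) + 1)) *
                              ψ (p.2 ⟨0, hn⟩ - ((k : ℝ) + 1))) *
                            ∏ r : Fin n,
                              (if r = ⟨0, hn⟩ then 1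
                               else ψ (p.1 r - 1) * ψ (p.2 r - 1)) : ℝ) : ℂ)) f g)
                      1 volume)
                ≤ ENNReal.ofReal
                    (C * (Real.sqrt (∑' l : ℕ, (cc (l + 2)) ^ 2 *
                        (∑ j ∈ Finset.Ico 1 (l + 2), b j * d (l + 2 - j)) ^ 2) *
                      (∫ y : ℝ, ‖φ y‖ ^ 2) ^ n)) := by
  refine ⟨1 / 2, 1, by norm_num, by norm_num, ?_⟩
  intro n hn φ hφ ψ _ hψ hψ1 b d cc _ _ _ _ _ hbfin hdfin _ f g hf hg
  obtain ⟨N₁, hN₁⟩ := exists_bound_of_finite_support hbfin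
  obtain ⟨N₂, hN₂⟩ := exists_bound_of_finite_support hdfin
  obtain ⟨N, hb, hd⟩ : ∃ N, (∀ j, N ≤ j → b (j + 1) = 0) ∧ ∀ j, N ≤ j → d (j + 1) = 0 :=
    ⟨max N₁ N₂, fun j hj => hN₁ j (le_of_max_le_left hj), fun j hj => hN₂ j (le_of_max_le_right hj)⟩
  simp only [eLpNorm_one_eq_lintegral_enorm, enorm_biOp_eq ⟨0, hn⟩ hφ hψ hψ1 cc hb hd hf hg,
    lintegral_enorm_mul_radSum, lintegral_enorm_radSum]
  have hQ : ∑' l : ℕ, cc (l + 2) ^ 2 *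
      (∑ j ∈ Finset.Ico 1 (l + 2), b j * d (l + 2 - j)) ^ 2 =
      ∑ l ∈ Finset.range (2 * N), cc (l + 2) ^ 2 * convCoeff b d l ^ 2 :=
    tsum_eq_sum fun l hl => by
      have := convCoeff_eq_zero hb hd (l := l) (by simpa using hl)
      rw [convCoeff] at this
      simp [this]
  rw [hQ]
  set Q := √(∑ l ∈ Finset.range (2 * N), cc (l + 2) ^ 2 * convCoeff b d l ^ 2) with hQdef
  have hsplit : ∀ κ : ℝ, 0 ≤ κ →
      ENNReal.ofReal (κ * (Q * (∫ y : ℝ, ‖φ y‖ ^ 2) ^ n)) =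
        ∫⁻ x : Rn n, ‖(∏ r, φ (x r)) ^ 2‖ₑ * ENNReal.ofReal (κ * Q) := by
    intro κ hκ
    have hQ0 : 0 ≤ κ * Q := mul_nonneg hκ (Real.sqrt_nonneg _)
    rw [lintegral_mul_const' _ _ ENNReal.ofReal_ne_top, lintegral_prod_norm_sq, ← mul_assoc,
      ENNReal.ofReal_mul hQ0, mul_comm]
  rw [hsplit _ (by norm_num), hsplit _ zero_le_one]
  constructor
  · refine lintegral_mono fun x => ?_
    gcongr
    rw [hQdef, ← sum_norm_radCoeff_sq b d cc (x ⟨0, hn⟩)]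
    exact le_integral_norm_radSum _ _
  · refine lintegral_mono fun x => ?_
    gcongr
    rw [one_mul, hQdef, ← sum_norm_radCoeff_sq b d cc (x ⟨0, hn⟩)]
    exact integral_norm_radSum_le _ _
end
end
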